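/- arXiv:1308.0200 — 16 statements merged into one kernel-verified Lean document; each statement's English description precedes it below -/
import Mathlib

section
/- Let N ≥ 2 be an integer, let R be the multivariate polynomial ring over ℤ in the N+1 variables a, x_0, …, x_{N−1}, and let F be its field of fractions. Suppose (x_n)_{n∈ℤ} is a sequence of nonzero elements of F such that x_i equals the image of the variable x_i in F for 0 ≤ i ≤ N−1, and x_{n+N}·x_n = x_{n+N−1}·x_{n+1} + a·(x_{n+1} + x_{n+2} + … + x_{n+N−1}) for all n ∈ ℤ (where a denotes the image of the variable a). Then for every n ∈ ℤ, x_n lies in the subring of F generated by the images of a, x_0, …, x_{N−1} together with the inverses x_0^{−1}, …, x_{N−1}^{−1}; that is, every iterate is an integer-coefficient Laurent polynomial in the initial data x_0, …, x_{N−1} with polynomial dependence on a. -/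
theorem laurent_aux {F : Type*} [Field F] (N : ℕ) (hN : 2 ≤ N) (a : F) (x : ℤ → F)
    (hx : ∀ n : ℤ, x n ≠ 0)
    (hrec : ∀ n : ℤ, x (n + N) * x n =
      x (n + N - 1) * x (n + 1) + a * ∑ i ∈ Finset.Ico 1 N, x (n + (i : ℤ)))
    (L : Subring F) (hLa : a ∈ L) (hL : ∀ i : ℕ, i < N → x i ∈ L)
    (hLi : ∀ i : ℕ, i < N → (x i)⁻¹ ∈ L) : ∀ n : ℤ, x n ∈ L := by
  obtain ⟨M, rfl⟩ : ∃ M, N = M + 2 := ⟨N - 2, by omega⟩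
  set K : ℤ → F := fun n => (x n + x (n + 2) + a) / x (n + 1) with hK
  have hKx : ∀ n, K n * x (n + 1) = x n + x (n + 2) + a := fun n => by
    simp only [hK]; exact div_mul_cancel₀ _ (hx _)
  have hper : Function.Periodic K ((M : ℤ) + 1) := by
    intro n
    have h1 := hrec n
    have h2 := hrec (n + 1)
    rw [Finset.sum_Ico_eq_sum_range] at h1 h2
    rw [show M + 2 - 1 = M + 1 from rfl] at h1 h2
    rw [Finset.sum_range_succ'] at h1
    rw [Finset.sum_range_succ] at h2
    have e : ∑ k ∈ Finset.range M, x (n + ((1 + (k + 1) : ℕ) : ℤ))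
        = ∑ k ∈ Finset.range M, x (n + 1 + ((1 + k : ℕ) : ℤ)) := by
      refine Finset.sum_congr rfl fun k _ => ?_
      congr 1; push_cast; ring
    rw [e] at h1
    simp only [hK]
    rw [div_eq_div_iff (hx _) (hx _)]
    have q1 : n + ((M + 2 : ℕ) : ℤ) = n + M + 2 := by push_cast; ring
    have q2 : n + ((M + 2 : ℕ) : ℤ) - 1 = n + M + 1 := by push_cast; ring
    have q3 : n + 1 + ((M + 2 : ℕ) : ℤ) = n + M + 3 := by push_cast; ring
    have q4 : n + 1 + ((M + 2 : ℕ) : ℤ) - 1 = n + M + 2 := by push_cast; ring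
    have q5 : n + ((1 + 0 : ℕ) : ℤ) = n + 1 := by push_cast; ring
    have q6 : n + 1 + ((1 + M : ℕ) : ℤ) = n + M + 2 := by push_cast; ring
    have q7 : n + 1 + 1 = n + 2 := by ring
    rw [q2, q1, q5] at h1
    rw [q4, q3, q6, q7] at h2
    rw [show n + ((M : ℤ) + 1) = n + M + 1 by ring, show n + (M : ℤ) + 1 + 2 = n + M + 3 by ring,
      show n + (M : ℤ) + 1 + 1 = n + M + 2 by ring]
    linear_combination h2 - h1
  have hK0 : ∀ m : ℕ, m ≤ M → K m ∈ L := by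
    intro m hm
    rcases hm.lt_or_eq with hm | rfl
    · have e : K m = (x (m : ℕ) + x ((m + 2 : ℕ)) + a) * (x ((m + 1 : ℕ)))⁻¹ := by
        simp only [hK, div_eq_mul_inv]; push_cast; rfl
      rw [e]
      exact L.mul_mem (L.add_mem (L.add_mem (hL _ (by omega)) (hL _ (by omega))) hLa)
        (hLi _ (by omega))
    · have h1 := hrec 0
      have hS : ∑ i ∈ Finset.Ico 1 (m + 2), x ((0 : ℤ) + (i : ℤ))
          = ∑ i ∈ Finset.Ico 1 (m + 1), x (i : ℤ) + x ((m + 1 : ℕ) : ℤ) := by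
        rw [Finset.sum_Ico_succ_top (by omega)]
        simp
      rw [hS] at h1
      have hSL : ∑ i ∈ Finset.Ico 1 (m + 1), x (i : ℤ) ∈ L :=
        L.sum_mem fun i hi => hL i (by have := Finset.mem_Ico.1 hi; omega)
      set S := ∑ i ∈ Finset.Ico 1 (m + 1), x (i : ℤ)
      have e : K m = (x (m : ℕ) * x (0 : ℕ) + x ((m + 1 : ℕ)) * x (1 : ℕ)
          + a * (S + x ((m + 1 : ℕ))) + a * x (0 : ℕ)) * ((x ((m + 1 : ℕ)))⁻¹ * (x (0 : ℕ))⁻¹) := by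
        rw [← mul_inv, ← div_eq_mul_inv, eq_div_iff (mul_ne_zero (hx _) (hx _))]
        have h2 := hKx m
        have q1 : (0 : ℤ) + ((m + 2 : ℕ) : ℤ) - 1 = m + 1 := by push_cast; ring
        have q2 : (0 : ℤ) + ((m + 2 : ℕ) : ℤ) = m + 2 := by push_cast; ring
        rw [q1, q2] at h1
        push_cast at h1 ⊢
        linear_combination x 0 * h2 + h1
      rw [e]
      have l0 := hL 0 (by omega)
      have l1 := hL 1 (by omega)
      have lm := hL m (by omega)
      have lm1 := hL (m + 1) (by omega)
      have i0 := hLi 0 (by omega)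
      have i1 := hLi (m + 1) (by omega)
      exact L.mul_mem (L.add_mem (L.add_mem (L.add_mem (L.mul_mem lm l0) (L.mul_mem lm1 l1))
        (L.mul_mem hLa (L.add_mem hSL lm1))) (L.mul_mem hLa l0)) (L.mul_mem i1 i0)
  have hKL : ∀ n : ℤ, K n ∈ L := by
    intro n
    have hp : (0 : ℤ) < (M : ℤ) + 1 := by positivity
    have e : K n = K (n % ((M : ℤ) + 1)) := by
      have := hper.int_mul (n / ((M : ℤ) + 1)) (n % ((M : ℤ) + 1))
      rw [← this]
      congr 1
      have := Int.emod_add_mul_ediv n ((M : ℤ) + 1)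
      simp only [Int.cast_id]
      linarith
    rw [e]
    have h0 := Int.emod_nonneg n hp.ne'
    have h1 := Int.emod_lt_of_pos n hp
    obtain ⟨m, hm⟩ := Int.eq_ofNat_of_zero_le h0
    rw [hm] at h1 ⊢
    exact hK0 m (by omega)
  have key : ∀ n : ℤ, x n ∈ L ∧ x (n + 1) ∈ L := by
    intro n
    induction n using Int.induction_on with
    | zero => exact ⟨by simpa using hL 0 (by omega), by simpa using hL 1 (by omega)⟩
    | succ i ih =>
      refine ⟨ih.2, ?_⟩
      have e : x ((i : ℤ) + 1 + 1) = K i * x (i + 1) - x i - a := by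
        rw [hKx, show (i : ℤ) + 1 + 1 = i + 2 by ring]; ring
      rw [e]
      exact L.sub_mem (L.sub_mem (L.mul_mem (hKL _) ih.2) ih.1) hLa
    | pred i ih =>
      have q : -(i : ℤ) - 1 + 1 = -i := by ring
      rw [q]
      refine ⟨?_, ih.1⟩
      have h := hKx (-(i : ℤ) - 1)
      rw [q, show -(i : ℤ) - 1 + 2 = -i + 1 by ring] at h
      have e : x (-(i : ℤ) - 1) = K (-(i : ℤ) - 1) * x (-i) - x (-i + 1) - a := by
        rw [h]; ring
      rw [e]
      exact L.sub_mem (L.sub_mem (L.mul_mem (hKL _) ih.1) ih.2) hLa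
  exact fun n => (key n).1

/-- Theorem 2.1 (Laurent property): for the recurrence
`x_{n+N} x_n = x_{n+N-1} x_{n+1} + a (x_{n+1} + ⋯ + x_{n+N-1})` with the parameter `a`
and the initial data `x_0, …, x_{N-1}` taken to be independent indeterminates
(working in the field of fractions of `ℤ[a, x_0, …, x_{N-1}]`), every iterate lies in
the subring generated by `a`, the `x_i` and their inverses, i.e. in
`ℤ[a, x_0^{±1}, …, x_{N-1}^{±1}]`. -/
theorem laurent_property (N : ℕ) (hN : 2 ≤ N)
    (a : FractionRing (MvPolynomial (Option (Fin N)) ℤ))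
    (ha : a = algebraMap (MvPolynomial (Option (Fin N)) ℤ) _
      (MvPolynomial.X (none : Option (Fin N))))
    (x : ℤ → FractionRing (MvPolynomial (Option (Fin N)) ℤ))
    (hx : ∀ n : ℤ, x n ≠ 0)
    (hinit : ∀ i : Fin N, x ((i : ℕ) : ℤ) =
      algebraMap (MvPolynomial (Option (Fin N)) ℤ) _ (MvPolynomial.X (some i)))
    (hrec : ∀ n : ℤ, x (n + N) * x n =
      x (n + N - 1) * x (n + 1) + a * ∑ i ∈ Finset.Ico 1 N, x (n + (i : ℤ))) :
    ∀ n : ℤ, x n ∈ Subring.closure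
      ({a} ∪ Set.range (fun i : Fin N => x ((i : ℕ) : ℤ))
        ∪ Set.range (fun i : Fin N => (x ((i : ℕ) : ℤ))⁻¹)) := by
  refine laurent_aux N hN a x hx hrec _ (Subring.subset_closure (Or.inl (Or.inl rfl))) ?_ ?_
  · exact fun i hi => Subring.subset_closure (Or.inl (Or.inr ⟨⟨i, hi⟩, rfl⟩))
  · exact fun i hi => Subring.subset_closure (Or.inr ⟨⟨i, hi⟩, rfl⟩)
end

section
/- The determinant of the 3×3 matrix Ψ_n is independent of n: for all n ∈ ℤ, det Ψ_{n+1} = det Ψ_n. -/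
/-- Lemma 3.1: the determinant of the 3×3 matrix `Ψ_n`, with `(i,j)` entry
`x (n + i + (N-1)*j)`, is invariant under `n → n+1` for any nonvanishing solution
of the recurrence `x_{n+N} x_n = x_{n+N-1} x_{n+1} + a (x_{n+1} + ⋯ + x_{n+N-1})`. -/
theorem det_psi_invariant {K : Type*} [Field K] (N : ℕ) (hN : 2 ≤ N) (a : K)
    (x : ℤ → K) (hx : ∀ n : ℤ, x n ≠ 0)
    (hrec : ∀ n : ℤ, x (n + N) * x n =
      x (n + N - 1) * x (n + 1) + a * ∑ i ∈ Finset.Ico 1 N, x (n + (i : ℤ))) :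
    ∀ n : ℤ,
      Matrix.det (Matrix.of fun i j : Fin 3 =>
        x ((n + 1) + ((i : ℕ) : ℤ) + ((N : ℤ) - 1) * ((j : ℕ) : ℤ))) =
      Matrix.det (Matrix.of fun i j : Fin 3 =>
        x (n + ((i : ℕ) : ℤ) + ((N : ℤ) - 1) * ((j : ℕ) : ℤ))) := by
  obtain ⟨M, rfl⟩ : ∃ M, N = M + 1 := ⟨N - 1, by omega⟩
  have hS : ∀ m : ℤ, ∑ i ∈ Finset.Ico 1 (M + 1), x (m + 1 + (i : ℤ))
      = ∑ i ∈ Finset.Ico 1 (M + 1), x (m + (i : ℤ)) + x (m + 1 + M) - x (m + 1) := by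
    intro m
    have h := Finset.sum_range_succ (fun i : ℕ => x (m + 1 + (i : ℤ))) M
    have h' := Finset.sum_range_succ' (fun i : ℕ => x (m + 1 + (i : ℤ))) M
    rw [Finset.sum_Ico_eq_sum_range, Finset.sum_Ico_eq_sum_range]
    have e1 : ∑ k ∈ Finset.range (M + 1 - 1), x (m + 1 + ((1 + k : ℕ) : ℤ))
        = ∑ k ∈ Finset.range M, x (m + 1 + ((k + 1 : ℕ) : ℤ)) :=
      Finset.sum_congr rfl (fun k _ => by rw [Nat.add_comm 1 k])
    have e2 : ∑ k ∈ Finset.range (M + 1 - 1), x (m + ((1 + k : ℕ) : ℤ))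
        = ∑ k ∈ Finset.range M, x (m + 1 + (k : ℤ)) :=
      Finset.sum_congr rfl (fun k _ => by congr 1; push_cast; ring)
    have e3 : x (m + 1 + ((0 : ℕ) : ℤ)) = x (m + 1) := by simp
    rw [e1, e2]
    rw [h, e3] at h'
    linear_combination -h'
  have key : ∀ m : ℤ, (x (m + M + 2) + x (m + M) + a) * x (m + 1)
      = (x (m + 2) + x m + a) * x (m + M + 1) := by
    intro m
    have h0 := hrec m
    have h1 := hrec (m + 1)
    rw [hS m] at h1
    rw [show m + ((M + 1 : ℕ) : ℤ) - 1 = m + M by push_cast; ring,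
      show m + ((M + 1 : ℕ) : ℤ) = m + M + 1 by push_cast; ring] at h0
    rw [show m + 1 + ((M + 1 : ℕ) : ℤ) - 1 = m + M + 1 by push_cast; ring,
      show m + 1 + ((M + 1 : ℕ) : ℤ) = m + M + 2 by push_cast; ring,
      show m + 1 + 1 = m + 2 by ring, show m + 1 + (M : ℤ) = m + M + 1 by ring] at h1
    linear_combination h1 - h0
  have step : ∀ m : ℤ, ∃ k : K, x (m + 2) + x m + a = k * x (m + 1) ∧
      x (m + M + 2) + x (m + M) + a = k * x (m + M + 1) ∧
      x (m + 2 * M + 2) + x (m + 2 * M) + a = k * x (m + 2 * M + 1) := by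
    intro m
    have g1 : x (m + 2) + x m + a = (x (m + 2) + x m + a) / x (m + 1) * x (m + 1) := by
      rw [div_mul_cancel₀ _ (hx _)]
    generalize (x (m + 2) + x m + a) / x (m + 1) = k at g1
    have g2 : x (m + M + 2) + x (m + M) + a = k * x (m + M + 1) := by
      apply mul_right_cancel₀ (hx (m + 1))
      rw [key, g1]; ring
    refine ⟨k, g1, g2, ?_⟩
    have h := key (m + M)
    rw [show m + (M : ℤ) + M = m + 2 * M by ring] at h
    apply mul_right_cancel₀ (hx (m + M + 1))
    rw [h, g2]; ring
  intro n
  obtain ⟨k, a0, a1, a2⟩ := step n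
  obtain ⟨l, b0, b1, b2⟩ := step (n + 1)
  have c : ∀ z : ℤ, n + 1 + z + 2 = n + z + 3 ∧ n + 1 + z = n + z + 1 ∧
    n + 1 + z + 1 = n + z + 2 := fun z => ⟨by ring, by ring, by ring⟩
  simp only [c] at b1 b2
  rw [show n + 1 + 2 = n + 3 by ring, show n + 1 + 1 = n + 2 by ring] at b0
  rw [show n + (M : ℤ) + 1 + 1 = n + M + 2 by ring,
    show n + (M : ℤ) + 1 + 2 = n + M + 3 by ring] at b1
  rw [show n + 2 * (M : ℤ) + 1 + 1 = n + 2 * M + 2 by ring,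
    show n + 2 * (M : ℤ) + 1 + 2 = n + 2 * M + 3 by ring] at b2
  rw [Matrix.det_fin_three, Matrix.det_fin_three]
  have d : ∀ i j : ℤ, n + 1 + i + (((M + 1 : ℕ) : ℤ) - 1) * j = n + j * M + (i + 1) ∧
      n + i + (((M + 1 : ℕ) : ℤ) - 1) * j = n + j * M + i := fun i j =>
    ⟨by push_cast; ring, by push_cast; ring⟩
  simp only [Matrix.of_apply, (d _ _).1, (d _ _).2]
  norm_num
  rw [eq_sub_of_add_eq (eq_sub_of_add_eq b0), eq_sub_of_add_eq (eq_sub_of_add_eq b1),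
    eq_sub_of_add_eq (eq_sub_of_add_eq b2),
    eq_sub_of_add_eq' (eq_sub_of_add_eq a0), eq_sub_of_add_eq' (eq_sub_of_add_eq a1),
    eq_sub_of_add_eq' (eq_sub_of_add_eq a2)]
  ring
end

section
/- Suppose additionally that D_n := x_n·x_{n+N} − x_{n+1}·x_{n+N−1} is nonzero for every n ∈ ℤ. Then the 4×4 matrix Ψ̂_n has vanishing determinant: det Ψ̂_n = 0 for all n ∈ ℤ. -/
theorem sum_shift_aux {K : Type*} [Field K] (x : ℤ → K) (n : ℤ) (N : ℕ) (hN : 1 ≤ N) :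
    ∑ i ∈ Finset.Ico 1 N, x (n + 1 + (i : ℤ)) =
      ∑ i ∈ Finset.Ico 1 N, x (n + (i : ℤ)) + x (n + N) - x (n + 1) := by
  induction N, hN using Nat.le_induction with
  | base => simp
  | succ k hk ih =>
    rw [Finset.sum_Ico_succ_top hk, Finset.sum_Ico_succ_top hk, ih]
    have e : n + 1 + (k : ℤ) = n + ((k + 1 : ℕ) : ℤ) := by push_cast; ring
    rw [e]
    ring

/-- Corollary 3.3: if moreover `D_n = x_n x_{n+N} - x_{n+1} x_{n+N-1}` is nonzero for all `n`,
then the 4×4 matrix `Ψ̂_n` with `(i,j)` entry `x (n + i + (N-1)*j)` has vanishing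
determinant. -/
theorem det_psihat_zero {K : Type*} [Field K] (N : ℕ) (hN : 2 ≤ N) (a : K)
    (x : ℤ → K) (hx : ∀ n : ℤ, x n ≠ 0)
    (hrec : ∀ n : ℤ, x (n + N) * x n =
      x (n + N - 1) * x (n + 1) + a * ∑ i ∈ Finset.Ico 1 N, x (n + (i : ℤ)))
    (hD : ∀ n : ℤ, x n * x (n + N) - x (n + 1) * x (n + N - 1) ≠ 0) :
    ∀ n : ℤ,
      Matrix.det (Matrix.of fun i j : Fin 4 =>
        x (n + ((i : ℕ) : ℤ) + ((N : ℤ) - 1) * ((j : ℕ) : ℤ))) = 0 := by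
  have key : ∀ n : ℤ, (x (n + ((N : ℤ) - 1) + 1) + x (n + ((N : ℤ) - 1) - 1) + a) / x (n + ((N : ℤ) - 1))
      = (x (n + 1) + x (n - 1) + a) / x n := by
    intro n
    rw [div_eq_div_iff (hx _) (hx _)]
    have h1 := hrec n
    have h0 := hrec (n - 1)
    have hs := sum_shift_aux x (n - 1) N (by omega)
    rw [show n - 1 + 1 = n by ring] at hs h0
    rw [show n - 1 + (N : ℤ) = n + ((N : ℤ) - 1) by ring] at hs h0
    rw [hs, show n + (N : ℤ) - 1 = n + ((N : ℤ) - 1) by ring] at h1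
    rw [show n + ((N : ℤ) - 1) + 1 = n + N by ring]
    linear_combination h1 - h0
  set J : ℤ → K := fun n => (x (n + 1) + x (n - 1) + a) / x n with hJ
  have hper : ∀ (j : ℕ) (n : ℤ), J (n + ((N : ℤ) - 1) * j) = J n := by
    intro j
    induction j with
    | zero => intro n; simp
    | succ k ih =>
      intro n
      rw [← ih n, show n + ((N : ℤ) - 1) * ((k + 1 : ℕ) : ℤ)
        = n + ((N : ℤ) - 1) * k + ((N : ℤ) - 1) by push_cast; ring]
      exact key _
  have hlin : ∀ n, x (n + 1) + x (n - 1) + a = J n * x n := fun n => by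
    simp only [hJ]
    rw [div_mul_cancel₀ _ (hx n)]
  intro n
  rw [← Matrix.exists_vecMul_eq_zero_iff]
  refine ⟨![-1, 1 + J (n + 1), -1 - J (n + 2), 1], fun h => ?_, ?_⟩
  · have := congrFun h 3
    simp at this
  · funext j
    have e1 := hlin (n + 1 + ((N : ℤ) - 1) * ((j : ℕ) : ℤ))
    have e2 := hlin (n + 2 + ((N : ℤ) - 1) * ((j : ℕ) : ℤ))
    rw [hper] at e1 e2
    simp only [Matrix.vecMul, dotProduct, Fin.sum_univ_four, Matrix.of_apply]
    generalize ((N : ℤ) - 1) * ((j : ℕ) : ℤ) = m at e1 e2 ⊢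
    rw [show n + 1 + m + 1 = n + 2 + m by ring, show n + 1 + m - 1 = n + m by ring] at e1
    rw [show n + 2 + m + 1 = n + 3 + m by ring, show n + 2 + m - 1 = n + 1 + m by ring] at e2
    simp
    linear_combination e2 - e1
end

section
/- The quantities J_n = (x_{n+2} + x_n + a)/x_{n+1} are periodic with period N−1, i.e. J_{n+N−1} = J_n for all n ∈ ℤ, and the iterates satisfy the homogeneous linear relation with periodic coefficients x_{n+3} − (1 + J_{n+1})·x_{n+2} + (1 + J_n)·x_{n+1} − x_n = 0 for all n ∈ ℤ. -/
/-- Theorem 3.4 (second half): the quantities `J_n = (x_{n+2} + x_n + a)/x_{n+1}` are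
periodic with period `N-1`, and the iterates satisfy the homogeneous linear relation
`x_{n+3} - (1 + J_{n+1}) x_{n+2} + (1 + J_n) x_{n+1} - x_n = 0`. -/
theorem periodic_linear_relation {K : Type*} [Field K] (N : ℕ) (hN : 2 ≤ N) (a : K)
    (x : ℤ → K) (hx : ∀ n : ℤ, x n ≠ 0)
    (hrec : ∀ n : ℤ, x (n + N) * x n =
      x (n + N - 1) * x (n + 1) + a * ∑ i ∈ Finset.Ico 1 N, x (n + (i : ℤ)))
    (J : ℤ → K) (hJ : ∀ n : ℤ, J n = (x (n + 2) + x n + a) / x (n + 1)) :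
    (∀ n : ℤ, J (n + ((N : ℤ) - 1)) = J n) ∧
    (∀ n : ℤ, x (n + 3) - (1 + J (n + 1)) * x (n + 2) + (1 + J n) * x (n + 1) - x n = 0) := by
  have hsum : ∀ n : ℤ, ∀ M : ℕ, 1 ≤ M →
      ∑ i ∈ Finset.Ico 1 M, x (n + 1 + (i : ℤ)) + x (n + 1) =
      ∑ i ∈ Finset.Ico 1 M, x (n + (i : ℤ)) + x (n + M) := by
    intro n M hM
    induction M, hM using Nat.le_induction with
    | base => simp
    | succ k hk ih =>
      rw [Finset.sum_Ico_succ_top hk, Finset.sum_Ico_succ_top hk]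
      have e : n + 1 + (k : ℤ) = n + ((k + 1 : ℕ) : ℤ) := by push_cast; ring
      rw [e]
      linear_combination ih
  constructor
  · intro n
    rw [hJ, hJ]
    have h0 := hrec n
    have h1 := hrec (n + 1)
    have hs := hsum n N (by omega)
    have e1 : n + ((N : ℤ) - 1) + 2 = n + 1 + N := by ring
    have e2 : n + ((N : ℤ) - 1) + 1 = n + N := by ring
    have e3 : n + ((N : ℤ) - 1) = n + N - 1 := by ring
    have e4 : n + 1 + (N : ℤ) - 1 = n + N := by ring
    have e5 : n + 1 + 1 = n + 2 := by ring
    rw [e4, e5] at h1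
    rw [e1, e2, e3, div_eq_div_iff (hx _) (hx _)]
    linear_combination h1 - h0 + a * hs
  · intro n
    have h0 : J n * x (n + 1) = x (n + 2) + x n + a := by
      rw [hJ, div_mul_cancel₀ _ (hx _)]
    have h1 : J (n + 1) * x (n + 2) = x (n + 3) + x (n + 1) + a := by
      have e1 : n + 1 + 2 = n + 3 := by ring
      have e2 : n + 1 + 1 = n + 2 := by ring
      rw [hJ, e1, e2, div_mul_cancel₀ _ (hx _)]
    linear_combination h0 - h1
end

section
/- There exists a constant K ∈ 𝕂 (independent of n) such that the iterates satisfy the homogeneous linear relation x_{n+3(N−1)} − K·(x_{n+2(N−1)} − x_{n+(N−1)}) − x_n = 0 for all n ∈ ℤ. -/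
theorem transfer_aux {𝕂 : Type*} [Field 𝕂] (J : ℤ → 𝕂) (m : ℕ) :
    ∃ p q r s : 𝕂, p * s - q * r = 1 ∧ ∀ u : ℤ → 𝕂,
      (∀ n, u (n + 2) = J n * u (n + 1) - u n) →
      u m = p * u 0 + q * u 1 ∧ u (m + 1) = r * u 0 + s * u 1 := by
  induction m with
  | zero => exact ⟨1, 0, 0, 1, by ring, fun u _ => by simp⟩
  | succ m ih =>
    obtain ⟨p, q, r, s, hd, h⟩ := ih
    refine ⟨r, s, J m * r - p, J m * s - q, by linear_combination hd, fun u hu => ?_⟩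
    obtain ⟨h1, h2⟩ := h u hu
    have h3 := hu m
    have e : ((m + 1 : ℕ) : ℤ) = m + 1 := by push_cast; ring
    have e2 : (m : ℤ) + 1 + 1 = m + 2 := by ring
    rw [e, e2]
    refine ⟨h2, ?_⟩
    rw [h3, h1, h2]; ring

theorem zero_aux {𝕂 : Type*} [Field 𝕂] (J : ℤ → 𝕂) (z : ℤ → 𝕂)
    (hz : ∀ n, z (n + 2) = J n * z (n + 1) - z n) (h0 : z 0 = 0) (h1 : z 1 = 0) (n : ℤ) :
    z n = 0 := by
  have key : z n = 0 ∧ z (n + 1) = 0 := by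
    induction n using Int.induction_on with
    | zero => exact ⟨h0, by simpa using h1⟩
    | succ i ih =>
      refine ⟨ih.2, ?_⟩
      have := hz i
      rw [ih.1, ih.2] at this
      rw [show (i : ℤ) + 1 + 1 = i + 2 by ring, this]; ring
    | pred i ih =>
      have := hz (-(i : ℤ) - 1)
      rw [show -(i : ℤ) - 1 + 2 = -i + 1 by ring, show -(i : ℤ) - 1 + 1 = -i by ring,
        ih.1, ih.2] at this
      rw [show -(i : ℤ) - 1 + 1 = -i by ring]
      exact ⟨by linear_combination this, ih.1⟩
  exact key.1

/-- Theorem 3.4 (first half): there is a constant `K` (a first integral) such that the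
iterates satisfy the constant-coefficient homogeneous linear relation
`x_{n+3(N-1)} - K (x_{n+2(N-1)} - x_{n+(N-1)}) - x_n = 0`. -/
theorem constant_linear_relation {𝕂 : Type*} [Field 𝕂] (N : ℕ) (hN : 2 ≤ N) (a : 𝕂)
    (x : ℤ → 𝕂) (hx : ∀ n : ℤ, x n ≠ 0)
    (hrec : ∀ n : ℤ, x (n + N) * x n =
      x (n + N - 1) * x (n + 1) + a * ∑ i ∈ Finset.Ico 1 N, x (n + (i : ℤ))) :
    ∃ K : 𝕂, ∀ n : ℤ,
      x (n + 3 * ((N : ℤ) - 1)) - K * (x (n + 2 * ((N : ℤ) - 1)) - x (n + ((N : ℤ) - 1)))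
        - x n = 0 := by
  obtain ⟨M, rfl⟩ : ∃ M, N = M + 1 := ⟨N - 1, by omega⟩
  have hS : ∀ n : ℤ, ∑ i ∈ Finset.Ico 1 (M + 1), x (n + 1 + (i : ℤ)) + x (n + 1)
      = ∑ i ∈ Finset.Ico 1 (M + 1), x (n + (i : ℤ)) + x (n + M + 1) := by
    intro n
    rw [Finset.sum_Ico_eq_sum_range, Finset.sum_Ico_eq_sum_range]
    have h1 := Finset.sum_range_succ (fun i : ℕ => x (n + 1 + (i : ℤ))) M
    have h2 := Finset.sum_range_succ' (fun i : ℕ => x (n + 1 + (i : ℤ))) M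
    have h3 := h2.symm.trans h1
    simp only [Nat.add_sub_cancel]
    convert h3 using 2
    · exact Finset.sum_congr rfl fun i _ => by congr 1; push_cast; ring
    · simp
    · exact Finset.sum_congr rfl fun i _ => by congr 1; push_cast; ring
    · congr 1; ring
  set J : ℤ → 𝕂 := fun n => (x (n + 2) + x n + a) / x (n + 1) with hJ
  have hJx : ∀ n, x (n + 2) = J n * x (n + 1) - x n - a := by
    intro n
    have := hx (n + 1)
    simp only [hJ]; field_simp; ring
  have hper : ∀ n, J (n + M) = J n := by
    intro n
    simp only [hJ]
    rw [div_eq_div_iff (hx _) (hx _)]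
    have e1 := hrec n
    have e2 := hrec (n + 1)
    have e3 := hS n
    push_cast at e1 e2
    rw [show n + ((M : ℤ) + 1) - 1 = n + M by ring,
      show n + ((M : ℤ) + 1) = n + M + 1 by ring] at e1
    rw [show n + 1 + ((M : ℤ) + 1) - 1 = n + M + 1 by ring,
      show n + 1 + ((M : ℤ) + 1) = n + M + 2 by ring,
      show n + 1 + 1 = n + 2 by ring] at e2
    linear_combination e2 - e1 + a * e3
  obtain ⟨p, q, r, s, hd, h⟩ := transfer_aux J M
  set y : ℤ → 𝕂 := fun n => x (n + M) - x n with hy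
  have hyr : ∀ n, y (n + 2) = J n * y (n + 1) - y n := by
    intro n
    have e1 := hJx n
    have e2 := hJx (n + M)
    rw [hper] at e2
    simp only [hy]
    rw [show n + 2 + (M : ℤ) = n + M + 2 by ring, show n + 1 + (M : ℤ) = n + M + 1 by ring]
    linear_combination e2 - e1
  have shift : ∀ u : ℤ → 𝕂, (∀ n, u (n + 2) = J n * u (n + 1) - u n) →
      ∀ n, u (n + 2 + M) = J n * u (n + 1 + M) - u (n + M) := by
    intro u hu n
    have := hu (n + M)
    rw [hper] at this
    rw [show n + 2 + (M : ℤ) = n + M + 2 by ring, show n + 1 + (M : ℤ) = n + M + 1 by ring, this]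
  have hy1 := shift y hyr
  have hy2 := shift (fun n => y (n + M)) hy1
  obtain ⟨a1, a2⟩ := h y hyr
  obtain ⟨b1, b2⟩ := h (fun n => y (n + M)) hy1
  beta_reduce at b1 b2 hy2
  rw [show (0 : ℤ) + M = M by ring, show (1 : ℤ) + M = M + 1 by ring] at b1 b2
  have hz := zero_aux J (fun n => y (n + M + M) - (p + s) * y (n + M) + y n)
    (fun n => by
      beta_reduce
      linear_combination hy2 n - (p + s) * hy1 n + hyr n)
    (by
      beta_reduce
      rw [show (0 : ℤ) + M = M by ring, b1, a1, a2]
      linear_combination -(y 0) * hd)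
    (by
      beta_reduce
      rw [show (1 : ℤ) + M = M + 1 by ring, b2, a1, a2]
      linear_combination -(y 1) * hd)
  refine ⟨p + s + 1, fun n => ?_⟩
  have := hz n
  simp only [hy] at this
  push_cast
  rw [show n + 3 * ((M : ℤ) + 1 - 1) = n + M + M + M by ring,
    show n + 2 * ((M : ℤ) + 1 - 1) = n + M + M by ring,
    show n + ((M : ℤ) + 1 - 1) = n + M by ring]
  linear_combination this
end

section
/- Set p = N − 1 and let κ be the trace of the ordered product M = L_0·L_1·⋯·L_{p−1} of the 2×2 matrices L_i = [[0, −1], [1, J_i]], where J_i = (x_{i+2} + x_i + a)/x_{i+1}. Then the iterates satisfy x_{n+3p} − (κ + 1)·(x_{n+2p} − x_{n+p}) − x_n = 0 for all n ∈ ℤ; that is, the constant coefficient K in the linear relation equals 1 plus the trace of the 2×2 monodromy matrix built from the period-p quantities J_0, …, J_{p−1}. -/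
lemma aux_prod {K : Type*} [Field K] (J f : ℤ → K)
    (hf : ∀ n, f (n + 2) = J n * f (n + 1) - f n) (k : ℕ) :
    Matrix.vecMul ![f 0, f 1] (((List.range k).map (fun i : ℕ =>
      !![(0 : K), -1; 1, J (i : ℤ)])).prod) = ![f k, f (k + 1)] := by
  induction k with
  | zero => simp
  | succ k ih =>
    rw [List.range_succ, List.map_append, List.prod_append, ← Matrix.vecMul_vecMul, ih]
    have h := hf k
    have e : ((k : ℤ) + 1 + 1) = k + 2 := by ring
    ext i
    fin_cases i
    · simp [Matrix.vecMul, dotProduct, Fin.sum_univ_two]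
    · simp [Matrix.vecMul, dotProduct, Fin.sum_univ_two, e, h]
      ring

lemma aux_det {K : Type*} [Field K] (J : ℤ → K) (k : ℕ) :
    (((List.range k).map (fun i : ℕ =>
      !![(0 : K), -1; 1, J (i : ℤ)])).prod).det = 1 := by
  induction k with
  | zero => simp
  | succ k ih =>
    rw [List.range_succ, List.map_append, List.prod_append, Matrix.det_mul, ih]
    simp [Matrix.det_fin_two]

lemma aux_ch {K : Type*} [Field K] (M : Matrix (Fin 2) (Fin 2) K) (hM : M.det = 1)
    (a b c d e f : K) (h1 : Matrix.vecMul ![a, b] M = ![c, d])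
    (h2 : Matrix.vecMul ![c, d] M = ![e, f]) :
    e - M.trace * c + a = 0 ∧ f - M.trace * d + b = 0 := by
  have h10 := congrFun h1 0
  have h11 := congrFun h1 1
  have h20 := congrFun h2 0
  have h21 := congrFun h2 1
  simp [Matrix.vecMul, dotProduct, Fin.sum_univ_two] at h10 h11 h20 h21
  rw [Matrix.det_fin_two] at hM
  rw [Matrix.trace_fin_two]
  subst h10 h11
  rw [← h20, ← h21]
  constructor
  · linear_combination (-a) * hM
  · linear_combination (-b) * hM

lemma aux_zero {K : Type*} [Field K] (J e : ℤ → K)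
    (he : ∀ n, e (n + 2) = J n * e (n + 1) - e n) (h0 : e 0 = 0) (h1 : e 1 = 0) (n : ℤ) :
    e n = 0 ∧ e (n + 1) = 0 := by
  induction n using Int.induction_on with
  | zero => simp [h0, h1]
  | succ i ih =>
    refine ⟨ih.2, ?_⟩
    have := he i
    rw [ih.1, ih.2] at this
    rw [show (i : ℤ) + 1 + 1 = i + 2 by ring, this]; simp
  | pred i ih =>
    have := he (-(i : ℤ) - 1)
    rw [show -(i : ℤ) - 1 + 2 = -i + 1 by ring, show -(i : ℤ) - 1 + 1 = -i by ring,
      ih.1, ih.2] at this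
    refine ⟨by linear_combination this, ?_⟩
    rw [show -(i : ℤ) - 1 + 1 = -i by ring]; exact ih.1

/-- Theorem 4.2: with `p = N - 1` and `κ` the trace of the ordered product
`M = L_0 ⋯ L_{p-1}` of the matrices `L_i = [[0,-1],[1,J_i]]`, where
`J_i = (x_{i+2} + x_i + a)/x_{i+1}`, the iterates satisfy
`x_{n+3p} - (κ+1)(x_{n+2p} - x_{n+p}) - x_n = 0`. -/
theorem monodromy_linear_relation {K : Type*} [Field K] (N : ℕ) (hN : 2 ≤ N) (a : K)
    (x : ℤ → K) (hx : ∀ n : ℤ, x n ≠ 0)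
    (hrec : ∀ n : ℤ, x (n + N) * x n =
      x (n + N - 1) * x (n + 1) + a * ∑ i ∈ Finset.Ico 1 N, x (n + (i : ℤ)))
    (p : ℕ) (hp : p = N - 1)
    (κ : K)
    (hκ : κ = Matrix.trace (((List.range p).map (fun i : ℕ =>
      !![(0 : K), -1; 1, (x ((i : ℤ) + 2) + x (i : ℤ) + a) / x ((i : ℤ) + 1)])).prod)) :
    ∀ n : ℤ,
      x (n + 3 * (p : ℤ)) - (κ + 1) * (x (n + 2 * (p : ℤ)) - x (n + (p : ℤ))) - x n = 0 := by
  obtain rfl : N = p + 1 := by omega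
  obtain ⟨J, hJ⟩ : ∃ J : ℤ → K, J = fun i => (x (i + 2) + x i + a) / x (i + 1) := ⟨_, rfl⟩
  have hκ' : κ = Matrix.trace (((List.range p).map (fun i : ℕ =>
      !![(0 : K), -1; 1, J (i : ℤ)])).prod) := by rw [hκ, hJ]
  have hxJ : ∀ n, x (n + 2) = J n * x (n + 1) - x n - a := by
    intro n
    have := hx (n + 1)
    rw [hJ]; field_simp; ring
  have hper : ∀ n, J (n + p) = J n := by
    intro n
    have r0 := hrec n
    have r1 := hrec (n + 1)
    have s : (∑ i ∈ Finset.Ico 1 (p + 1), x (n + 1 + (i : ℤ))) + x (n + 1)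
        = (∑ i ∈ Finset.Ico 1 (p + 1), x (n + (i : ℤ))) + x (n + p + 1) := by
      rw [Finset.sum_Ico_eq_sum_range, Finset.sum_Ico_eq_sum_range]
      have h1 := Finset.sum_range_succ (fun k : ℕ => x (n + 1 + k)) p
      have h2 := Finset.sum_range_succ' (fun k : ℕ => x (n + 1 + k)) p
      rw [h1] at h2
      simp only [Nat.add_sub_cancel]
      push_cast at h2 ⊢
      simp only [add_assoc, add_comm, add_left_comm, zero_add, add_zero] at h2 ⊢
      linear_combination -h2
    push_cast at r0 r1
    rw [show n + 1 + ((p : ℤ) + 1) = n + p + 2 by ring,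
      show n + (p : ℤ) + 2 - 1 = n + p + 1 by ring, show n + 1 + 1 = n + 2 by ring] at r1
    rw [show n + ((p : ℤ) + 1) = n + p + 1 by ring,
      show n + (p : ℤ) + 1 - 1 = n + p by ring] at r0
    rw [hJ]
    simp only
    rw [div_eq_div_iff (hx _) (hx _)]
    linear_combination r1 - r0 + a * s
  let d : ℤ → K := fun n => x (n + p) - x n
  have hd : ∀ n, d (n + 2) = J n * d (n + 1) - d n := by
    intro n
    have h1 := hxJ n
    have h2 := hxJ (n + p)
    rw [hper] at h2
    simp only [d]
    rw [show n + 2 + (p : ℤ) = n + p + 2 by ring, show n + 1 + (p : ℤ) = n + p + 1 by ring]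
    linear_combination h2 - h1
  have hdp : ∀ n, d (n + 2 + p) = J n * d (n + 1 + p) - d (n + p) := by
    intro n
    have := hd (n + p)
    rw [hper] at this
    rw [show n + 2 + (p : ℤ) = n + p + 2 by ring, show n + 1 + (p : ℤ) = n + p + 1 by ring]
    exact this
  have hdpp : ∀ n, d (n + 2 + p + p) = J n * d (n + 1 + p + p) - d (n + p + p) := by
    intro n
    have := hdp (n + p)
    rw [hper] at this
    rw [show n + 2 + (p : ℤ) = n + p + 2 by ring, show n + 1 + (p : ℤ) = n + p + 1 by ring]
    exact this
  have m1 := aux_prod J d hd p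
  have m2 := aux_prod J (fun n => d (n + p)) hdp p
  simp only [zero_add] at m2
  rw [show (p : ℤ) + 1 = 1 + p by ring] at m1 m2
  obtain ⟨c0, c1⟩ := aux_ch _ (aux_det J p) _ _ _ _ _ _ m1 m2
  rw [← hκ'] at c0 c1
  intro n
  have key := (aux_zero J (fun n => d (n + p + p) - κ * d (n + p) + d n)
    (by
      intro n
      linear_combination hdpp n - κ * hdp n + hd n)
    (by simpa using c0) (by simpa using c1) n).1
  simp only [d] at key
  rw [show n + 3 * (p : ℤ) = n + p + p + p by ring, show n + 2 * (p : ℤ) = n + p + p by ring]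
  linear_combination key
end

section
/- Set p = N − 1 and let κ be the trace of the ordered product M = L_0·L_1·⋯·L_{p−1} of the 2×2 matrices L_i = [[0, −1], [1, J_i]], where J_i = (x_{i+2} + x_i + a)/x_{i+1}. Then there exists a sequence (t_n)_{n∈ℤ} in K that is periodic with period p (t_{n+p} = t_n for all n) such that the iterates satisfy the inhomogeneous linear relation x_{n+2p} − κ·x_{n+p} + x_n + a·t_n = 0 for all n ∈ ℤ. -/
open Matrix in
theorem aux_main {K : Type*} [Field K] (a : K) (x J : ℤ → K) (p : ℕ)
    (hJ : ∀ n, J (n + p) = J n) (hxJ : ∀ n, x (n + 2) = J n * x (n + 1) - x n - a) (κ : K)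
    (hκ : κ = Matrix.trace (((List.range p).map (fun i : ℕ => !![(0 : K), -1; 1, J i])).prod)) :
    ∃ t : ℤ → K, (∀ n : ℤ, t (n + (p : ℤ)) = t n) ∧
      (∀ n : ℤ, x (n + 2 * (p : ℤ)) - κ * x (n + (p : ℤ)) + x n + a * t n = 0) := by
  let L : ℤ → Matrix (Fin 2) (Fin 2) K := fun n => !![(0 : K), -1; 1, J n]
  have hL : ∀ n, L (n + p) = L n := fun n => by simp only [L, hJ]
  have hdL : ∀ n, (L n).det = 1 := fun n => by simp [L, Matrix.det_fin_two]
  let P : ℕ → ℤ → Matrix (Fin 2) (Fin 2) K :=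
    fun k n => ((List.range k).map (fun i : ℕ => L (n + i))).prod
  have P0 : ∀ n, P 0 n = 1 := fun n => by simp [P]
  have PS : ∀ k n, P (k + 1) n = P k n * L (n + k) := fun k n => by
    simp [P, List.range_succ]
  have PS' : ∀ k n, P (k + 1) n = L n * P k (n + 1) := by
    intro k
    induction k with
    | zero => intro n; simp [PS, P0]
    | succ k ih =>
      intro n
      rw [PS, ih, PS k (n + 1), Matrix.mul_assoc]
      congr 3
      push_cast; ring
  have hdP : ∀ k n, (P k n).det = 1 := by
    intro k n
    induction k with
    | zero => simp [P0]
    | succ k ih => rw [PS, Matrix.det_mul, ih, hdL, one_mul]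
  have hPp : ∀ k n, P k (n + p) = P k n := by
    intro k n
    induction k with
    | zero => simp [P0]
    | succ k ih => rw [PS, PS, ih, add_right_comm, hL]
  let W : ℕ → ℤ → (Fin 2 → K) := fun k n => Nat.rec 0 (fun k w => w ᵥ* L (n + k) + ![0, 1]) k
  have W0 : ∀ n, W 0 n = 0 := fun n => rfl
  have WS : ∀ k n, W (k + 1) n = W k n ᵥ* L (n + k) + ![0, 1] := fun k n => rfl
  have hWp : ∀ k n, W k (n + p) = W k n := by
    intro k n
    induction k with
    | zero => simp [W0]
    | succ k ih => rw [WS, WS, ih, add_right_comm, hL]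
  let V : ℤ → (Fin 2 → K) := fun n => ![x n, x (n + 1)]
  have VS : ∀ n, V (n + 1) = V n ᵥ* L n - a • ![0, 1] := by
    intro n
    have := hxJ n
    ext i
    fin_cases i
    · simp [V, L, Matrix.vecMul, dotProduct, Fin.sum_univ_two]
    · simp [V, L, Matrix.vecMul, dotProduct, Fin.sum_univ_two]
      rw [add_assoc, one_add_one_eq_two, this]; ring
  have VP : ∀ k n, V (n + (k : ℕ)) = V n ᵥ* P k n - a • W k n := by
    intro k n
    induction k with
    | zero => simp [P0, W0]
    | succ k ih =>
      rw [Nat.cast_succ, ← add_assoc, VS, ih, PS, WS, Matrix.sub_vecMul, Matrix.vecMul_vecMul,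
        smul_add, Matrix.smul_vecMul]
      abel
  have htr1 : ∀ n, (P p (n + 1)).trace = (P p n).trace := by
    intro n
    have h : P p n * L n = L n * P p (n + 1) := by rw [← PS', PS, hL]
    have hu : IsUnit (L n).det := by rw [hdL]; exact isUnit_one
    have h2 : P p (n + 1) = (L n)⁻¹ * (P p n * L n) := by
      rw [h, ← Matrix.mul_assoc, Matrix.nonsing_inv_mul _ hu, Matrix.one_mul]
    rw [h2, Matrix.trace_mul_comm, Matrix.mul_assoc, Matrix.mul_nonsing_inv _ hu, Matrix.mul_one]
  have htr : ∀ n, (P p n).trace = κ := by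
    have h0 : (P p 0).trace = κ := by rw [hκ]; simp [P, L]
    intro n
    induction n using Int.induction_on with
    | zero => exact h0
    | succ i ih => rw [htr1, ih]
    | pred i ih => rw [← htr1, sub_add_cancel, ih]
  refine ⟨fun n => (W p n ᵥ* P p n + W p n - κ • W p n) 0, fun n => by simp only [hPp, hWp], ?_⟩
  intro n
  have h1 := VP p n
  have h2 := VP p (n + p)
  rw [hPp, hWp] at h2
  have e : n + 2 * (p : ℤ) = n + p + p := by ring
  have hd := hdP p n
  have ht := htr n
  rw [Matrix.det_fin_two] at hd
  rw [Matrix.trace_fin_two] at ht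
  have a0 := congrFun h1 0
  have a1 := congrFun h1 1
  have b0 := congrFun h2 0
  rw [e]
  simp [V, Matrix.vecMul, dotProduct, Fin.sum_univ_two] at a0 a1 b0 ⊢
  rw [b0, a1, a0, ← ht]
  linear_combination (-x n) * hd

/-- Relation (34) from the proof of Theorem 4.2: with `p = N - 1` and `κ` the trace of the
ordered product `M = L_0 ⋯ L_{p-1}` of the matrices `L_i = [[0,-1],[1,J_i]]`, where
`J_i = (x_{i+2} + x_i + a)/x_{i+1}`, there is a period-`p` sequence `t_n` such that
`x_{n+2p} - κ x_{n+p} + x_n + a t_n = 0` for all `n`. -/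
theorem inhomogeneous_linear_relation {K : Type*} [Field K] (N : ℕ) (hN : 2 ≤ N) (a : K)
    (x : ℤ → K) (hx : ∀ n : ℤ, x n ≠ 0)
    (hrec : ∀ n : ℤ, x (n + N) * x n =
      x (n + N - 1) * x (n + 1) + a * ∑ i ∈ Finset.Ico 1 N, x (n + (i : ℤ)))
    (p : ℕ) (hp : p = N - 1)
    (κ : K)
    (hκ : κ = Matrix.trace (((List.range p).map (fun i : ℕ =>
      !![(0 : K), -1; 1, (x ((i : ℤ) + 2) + x (i : ℤ) + a) / x ((i : ℤ) + 1)])).prod)) :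
    ∃ t : ℤ → K, (∀ n : ℤ, t (n + (p : ℤ)) = t n) ∧
      (∀ n : ℤ, x (n + 2 * (p : ℤ)) - κ * x (n + (p : ℤ)) + x n + a * t n = 0) := by
  obtain ⟨q, rfl⟩ : ∃ q, N = q + 1 := ⟨N - 1, by omega⟩
  obtain rfl : p = q := by omega
  refine aux_main a x (fun n => (x (n + 2) + x n + a) / x (n + 1)) p ?_ ?_ κ hκ
  · intro n
    have hs : ∀ n : ℤ, ∑ i ∈ Finset.Ico 1 (p + 1), x (n + (i : ℤ))
        = ∑ i ∈ Finset.range p, x (n + 1 + (i : ℤ)) := by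
      intro n
      rw [Finset.sum_Ico_eq_sum_range]
      refine Finset.sum_congr (by simp) fun i _ => ?_
      push_cast
      rw [add_assoc]
    have h1 := hrec n
    have h2 := hrec (n + 1)
    rw [hs] at h1 h2
    have hd : ∑ i ∈ Finset.range p, x (n + 1 + 1 + (i : ℤ)) + x (n + 1)
        = ∑ i ∈ Finset.range p, x (n + 1 + (i : ℤ)) + x (n + 1 + p) := by
      rw [← Finset.sum_range_succ (fun i : ℕ => x (n + 1 + (i : ℤ))), Finset.sum_range_succ']
      simp [add_assoc, add_comm, add_left_comm]
    have e1 : n + ((p + 1 : ℕ) : ℤ) = n + p + 1 := by push_cast; ring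
    have e2 : n + 1 + ((p + 1 : ℕ) : ℤ) = n + p + 2 := by push_cast; ring
    have e3 : n + p + 1 - 1 = n + (p : ℤ) := by ring
    have e4 : n + p + 2 - 1 = n + (p : ℤ) + 1 := by ring
    have e5 : n + 1 + (p : ℤ) = n + p + 1 := by ring
    have e6 : n + 1 + 1 = n + 2 := by ring
    rw [e1, e3] at h1
    rw [e2, e4, e6] at h2
    rw [e5, e6] at hd
    show _ / _ = _ / _
    rw [div_eq_div_iff (hx _) (hx _)]
    linear_combination h2 - h1 + a * hd
  · intro n
    show _ = _ / _ * _ - _ - _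
    rw [div_mul_cancel₀ _ (hx _)]
    ring
end

section
/- For every n ∈ ℤ, the iterate x_n lies in the subring of K generated by the finite set {a, x_0, x_1, J_0, J_1, …, J_{N−2}}, where J_i = (x_{i+2} + x_i + a)/x_{i+1}; that is, x_n ∈ ℤ[a, x_0, x_1, J_0, …, J_{N−2}]. -/
/-- Corollary 3.5 (strengthened Laurent property): every iterate lies in the subring of `K`
generated by `a`, `x_0`, `x_1` and the periodic quantities `J_0, …, J_{N-2}`, where
`J_i = (x_{i+2} + x_i + a)/x_{i+1}`. -/
theorem strengthened_laurent {K : Type*} [Field K] (N : ℕ) (hN : 2 ≤ N) (a : K)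
    (x : ℤ → K) (hx : ∀ n : ℤ, x n ≠ 0)
    (hrec : ∀ n : ℤ, x (n + N) * x n =
      x (n + N - 1) * x (n + 1) + a * ∑ i ∈ Finset.Ico 1 N, x (n + (i : ℤ))) :
    ∀ n : ℤ, x n ∈ Subring.closure
      ({a, x 0, x 1} ∪ Set.range (fun i : Fin (N - 1) =>
        (x (((i : ℕ) : ℤ) + 2) + x ((i : ℕ) : ℤ) + a) / x (((i : ℕ) : ℤ) + 1))) := by
  have hsum : ∀ n : ℤ, ∑ i ∈ Finset.Ico 1 N, x (n + 1 + (i : ℤ))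
      = ∑ i ∈ Finset.Ico 1 N, x (n + (i : ℤ)) + x (n + N) - x (n + 1) := by
    intro n
    have h1 : 1 ≤ N := by omega
    clear hrec hN
    induction N, h1 using Nat.le_induction with
    | base => simp
    | succ k hk ih =>
      rw [Finset.sum_Ico_succ_top hk, Finset.sum_Ico_succ_top hk, ih]
      have : n + 1 + (k : ℤ) = n + ((k + 1 : ℕ) : ℤ) := by push_cast; ring
      rw [this]; ring
  obtain ⟨J, hJ⟩ : ∃ J : ℤ → K, ∀ n, J n = (x (n + 2) + x n + a) / x (n + 1) := ⟨_, fun _ => rfl⟩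
  have hper : ∀ n : ℤ, J (n + ((N - 1 : ℕ) : ℤ)) = J n := by
    intro n
    have hc : ((N - 1 : ℕ) : ℤ) = (N : ℤ) - 1 := by omega
    rw [hJ, hJ, hc, div_eq_div_iff (hx _) (hx _)]
    have e1 := hrec n
    have e2 := hrec (n + 1)
    rw [hsum] at e2
    have i1 : n + ((N : ℤ) - 1) + 2 = n + 1 + N := by ring
    have i2 : n + ((N : ℤ) - 1) + 1 = n + N := by ring
    have i3 : n + ((N : ℤ) - 1) = n + N - 1 := by ring
    have i4 : n + 1 + (N : ℤ) - 1 = n + N := by ring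
    have i5 : n + 1 + 1 = n + 2 := by ring
    rw [i4, i5] at e2
    rw [i1, i2, i3]
    linear_combination e2 - e1
  have hperm : ∀ n : ℤ, J (n % ((N - 1 : ℕ) : ℤ)) = J n := by
    intro n
    have hp : Function.Periodic J ((N - 1 : ℕ) : ℤ) := hper
    have := hp.int_mul (n / ((N - 1 : ℕ) : ℤ)) (n % ((N - 1 : ℕ) : ℤ))
    rw [← this]
    congr 1
    rw [Int.cast_id, mul_comm]
    exact (Int.emod_add_mul_ediv n _)
  set R := Subring.closure ({a, x 0, x 1} ∪ Set.range (fun i : Fin (N - 1) =>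
        (x (((i : ℕ) : ℤ) + 2) + x ((i : ℕ) : ℤ) + a) / x (((i : ℕ) : ℤ) + 1))) with hR
  have ha : a ∈ R := Subring.subset_closure (by simp)
  have h0 : x 0 ∈ R := Subring.subset_closure (by simp)
  have h1 : x 1 ∈ R := Subring.subset_closure (by simp)
  have hJR : ∀ n, J n ∈ R := by
    intro n
    rw [← hperm]
    have hpos : (0 : ℤ) < ((N - 1 : ℕ) : ℤ) := by omega
    obtain ⟨k, hk⟩ := Int.eq_ofNat_of_zero_le (Int.emod_nonneg n hpos.ne')
    have hlt := Int.emod_lt_of_pos n hpos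
    rw [hk] at hlt ⊢
    rw [hJ]
    exact Subring.subset_closure (Or.inr ⟨⟨k, by omega⟩, rfl⟩)
  have hlin : ∀ n, x (n + 2) + x n + a = J n * x (n + 1) := by
    intro n
    rw [hJ, div_mul_cancel₀ _ (hx _)]
  have key : ∀ n : ℤ, x n ∈ R ∧ x (n + 1) ∈ R := by
    intro n
    induction n using Int.induction_on with
    | zero => exact ⟨h0, by simpa using h1⟩
    | succ i ih =>
      refine ⟨ih.2, ?_⟩
      have e : x ((i : ℤ) + 1 + 1) = J i * x (i + 1) - x i - a := by
        rw [← hlin, show (i : ℤ) + 1 + 1 = i + 2 by ring]; ring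
      rw [e]
      exact R.sub_mem (R.sub_mem (R.mul_mem (hJR _) ih.2) ih.1) ha
    | pred i ih =>
      have e0 : (-(i : ℤ) - 1 + 1) = -i := by ring
      have e2 : (-(i : ℤ) - 1 + 2) = -i + 1 := by ring
      refine ⟨?_, by rw [e0]; exact ih.1⟩
      have e : x (-(i : ℤ) - 1) = J (-(i : ℤ) - 1) * x (-i) - x (-i + 1) - a := by
        have := hlin (-(i : ℤ) - 1)
        rw [e0, e2] at this
        rw [← this]; ring
      rw [e]
      exact R.sub_mem (R.sub_mem (R.mul_mem (hJR _) ih.1) ih.2) ha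
  exact fun n => (key n).1
end

section
/- Let k ≥ 1 be an integer and let (x_n)_{n∈ℤ} be a sequence of nonzero rational numbers satisfying x_{n+2k+1}·x_n = x_{n+2k}·x_{n+1} + x_{n+k} + x_{n+k+1} for all n ∈ ℤ, with initial data x_i = 1 for i = 0, 1, …, 2k. Then for all n ∈ ℤ, x_{n+6k} − (2k² + 8k + 4)·(x_{n+4k} − x_{n+2k}) − x_n = 0. -/
/-- `x` is given on the two blocks `[2km, 2km+k]`, `[2km+k, 2km+2k]` by quadratics. -/
def HHBlock (k : ℕ) (x : ℤ → ℚ) (m : ℤ) (a b c : ℚ) : Prop :=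
  c = 1 + ((k : ℚ) ^ 2 + 2 * k) * a ∧
  (2 * (k : ℚ) ^ 2 + 2 * k + 1) * a ^ 2 + a * b + (4 * k + 4) * a * c - b ^ 2 + 2 * b * c = 0 ∧
  (∀ i : ℕ, i ≤ k → x (2 * k * m + i) = a * (i : ℚ) ^ 2 + b * i + c) ∧
  (∀ i : ℕ, i ≤ k → x (2 * k * m + k + i) =
    ((1 + 2 * k) * a + b) * (i : ℚ) ^ 2 + (2 * k * a + b) * i + ((k : ℚ) ^ 2 * a + k * b + c))

def HHRec (k : ℕ) (x : ℤ → ℚ) : Prop :=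
  (∀ n : ℤ, x n ≠ 0) ∧ ∀ n : ℤ, x (n + 2 * k + 1) * x n =
      x (n + 2 * k) * x (n + 1) + x (n + k) + x (n + k + 1)

theorem HHBlock.step {k : ℕ} {x : ℤ → ℚ} {m : ℤ} {a b c : ℚ} (hr : HHRec k x)
    (h : HHBlock k x m a b c) :
    HHBlock k x (m + 1) ((1 + 2 * k) * a + b)
      ((1 + 6 * k + 12 * k ^ 2 + 4 * k ^ 3) * a + (2 + 6 * k + 2 * k ^ 2) * b + 2 * c)
      ((4 * k ^ 2 + 2 * k ^ 3) * a + (2 * k + k ^ 2) * b + c) := by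
  obtain ⟨hx, hrec⟩ := hr
  obtain ⟨hl, hq, h1, h2⟩ := h
  have h3 : ∀ i : ℕ, i ≤ k → x (2 * k * (m + 1) + i) = ((1 + 2 * k) * a + b) * (i : ℚ) ^ 2 +
      ((1 + 6 * k + 12 * k ^ 2 + 4 * k ^ 3) * a + (2 + 6 * k + 2 * k ^ 2) * b + 2 * c) * i +
      ((4 * k ^ 2 + 2 * k ^ 3) * a + (2 * k + k ^ 2) * b + c) := by
    intro i
    induction i with
    | zero =>
      intro _
      have := h2 k le_rfl
      rw [show (2 * k * m + k + k : ℤ) = 2 * k * (m + 1) + (0 : ℕ) by push_cast; ring] at this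
      rw [this]; push_cast; ring
    | succ i ih =>
      intro hi
      have e0 := ih (by omega)
      have e1 := h1 i (by omega)
      have e2 := h1 (i + 1) hi
      have e3 := h2 i (by omega)
      have e4 := h2 (i + 1) hi
      have r := hrec (2 * k * m + i)
      have nz := hx (2 * k * m + i)
      rw [show (2 * k * m + i + 2 * k + 1 : ℤ) = 2 * k * (m + 1) + (i + 1 : ℕ) by push_cast; ring,
        show (2 * k * m + i + 2 * k : ℤ) = 2 * k * (m + 1) + i by ring,
        show (2 * k * m + i + 1 : ℤ) = 2 * k * m + (i + 1 : ℕ) by push_cast; ring,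
        show (2 * k * m + i + k : ℤ) = 2 * k * m + k + i by ring,
        show (2 * k * m + k + i + 1 : ℤ) = 2 * k * m + k + (i + 1 : ℕ) by push_cast; ring,
        e0, e2, e3, e4] at r
      apply mul_right_cancel₀ nz
      rw [r, e1]
      push_cast
      generalize (i : ℚ) = t
      generalize (k : ℚ) = K at *
      clear r nz e0 e1 e2 e3 e4
      subst hl
      grind
  refine ⟨?_, ?_, h3, ?_⟩
  · generalize (k : ℚ) = K at *
    subst hl; ring
  · clear h3 h1 h2
    generalize (k : ℚ) = K at *
    subst hl; grind
  · intro i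
    induction i with
    | zero =>
      intro _
      have := h3 k le_rfl
      rw [show (2 * k * (m + 1) + k + (0 : ℕ) : ℤ) = 2 * k * (m + 1) + k by push_cast; ring]
      rw [this]; push_cast; ring
    | succ i ih =>
      intro hi
      have e0 := ih (by omega)
      have e1 := h2 i (by omega)
      have e2 := h2 (i + 1) hi
      have e3 := h3 i (by omega)
      have e4 := h3 (i + 1) hi
      have r := hrec (2 * k * m + k + i)
      have nz := hx (2 * k * m + k + i)
      rw [show (2 * k * m + k + i + 2 * k + 1 : ℤ) = 2 * k * (m + 1) + k + (i + 1 : ℕ) by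
          push_cast; ring,
        show (2 * k * m + k + i + 2 * k : ℤ) = 2 * k * (m + 1) + k + i by ring,
        show (2 * k * m + k + i + 1 : ℤ) = 2 * k * m + k + (i + 1 : ℕ) by push_cast; ring,
        show (2 * k * m + k + i + k : ℤ) = 2 * k * (m + 1) + i by ring,
        show (2 * k * (m + 1) + i + 1 : ℤ) = 2 * k * (m + 1) + (i + 1 : ℕ) by push_cast; ring,
        e0, e2, e3, e4] at r
      apply mul_right_cancel₀ nz
      rw [r, e1]
      push_cast
      generalize (i : ℚ) = t
      generalize (k : ℚ) = K at *
      clear r nz e0 e1 e2 e3 e4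
      subst hl
      grind

theorem HHRec.refl {k : ℕ} {x : ℤ → ℚ} (hr : HHRec k x) : HHRec k (fun n => x (-n)) := by
  refine ⟨fun n => hr.1 _, fun n => ?_⟩
  have := hr.2 (-(n + 2 * k + 1))
  rw [show (-(n + 2 * k + 1) + 2 * k + 1 : ℤ) = -n by ring,
    show (-(n + 2 * k + 1) + 2 * k : ℤ) = -(n + 1) by ring,
    show (-(n + 2 * k + 1) + 1 : ℤ) = -(n + 2 * k) by ring,
    show (-(n + 2 * k + 1) + k : ℤ) = -(n + k + 1) by ring,
    show (-(n + k + 1) + 1 : ℤ) = -(n + k) by ring] at this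
  linear_combination this

theorem HHBlock.refl {k : ℕ} {x : ℤ → ℚ} {m : ℤ} {a b c : ℚ} (h : HHBlock k x m a b c) :
    ∃ a' b' c', HHBlock k (fun n => x (-n)) (-m - 1) a' b' c' := by
  obtain ⟨hl, hq, h1, h2⟩ := h
  refine ⟨(1 + 2 * k) * a + b, -(2 * ((1 + 2 * k) * a + b) * k + (2 * k * a + b)),
    ((1 + 2 * k) * a + b) * k ^ 2 + (2 * k * a + b) * k + (k ^ 2 * a + k * b + c), ?_, ?_, ?_, ?_⟩
  · generalize (k : ℚ) = K at *
    subst hl; ring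
  · clear h1 h2
    generalize (k : ℚ) = K at *
    subst hl; grind
  · intro i hi
    have := h2 (k - i) (by omega)
    push_cast [Nat.cast_sub hi] at this
    beta_reduce
    rw [show (-(2 * k * (-m - 1) + i) : ℤ) = 2 * k * m + k + (k - i) by ring, this]
    ring
  · intro i hi
    have := h1 (k - i) (by omega)
    push_cast [Nat.cast_sub hi] at this
    beta_reduce
    rw [show (-(2 * k * (-m - 1) + k + i) : ℤ) = 2 * k * m + (k - i) by ring, this]
    ring

/-- Proposition 1.1 (Heideman–Hogan): the iterates of
`x_{n+2k+1} x_n = x_{n+2k} x_{n+1} + x_{n+k} + x_{n+k+1}` with all `2k+1` initial values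
equal to `1` satisfy `x_{n+6k} - (2k² + 8k + 4)(x_{n+4k} - x_{n+2k}) - x_n = 0`. -/
theorem heideman_hogan (k : ℕ) (hk : 1 ≤ k)
    (x : ℤ → ℚ) (hx : ∀ n : ℤ, x n ≠ 0)
    (hrec : ∀ n : ℤ, x (n + 2 * k + 1) * x n =
      x (n + 2 * k) * x (n + 1) + x (n + k) + x (n + k + 1))
    (hinit : ∀ i : ℕ, i ≤ 2 * k → x (i : ℤ) = 1) :
    ∀ n : ℤ, x (n + 6 * k) - (2 * (k : ℚ) ^ 2 + 8 * k + 4) * (x (n + 4 * k) - x (n + 2 * k))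
      - x n = 0 := by
  have hr : HHRec k x := ⟨hx, hrec⟩
  have key : ∀ m : ℤ, ∃ a b c, HHBlock k x m a b c := by
    intro m
    induction m using Int.induction_on with
    | zero =>
      refine ⟨0, 0, 1, by ring, by ring, fun i hi => ?_, fun i hi => ?_⟩
      · have := hinit i (by omega)
        simpa using this
      · have := hinit (k + i) (by omega)
        push_cast at this
        simpa using this
    | succ i ih =>
      obtain ⟨a, b, c, h⟩ := ih
      exact ⟨_, _, _, h.step hr⟩
    | pred i ih =>
      obtain ⟨a, b, c, h⟩ := ih
      obtain ⟨a', b', c', h'⟩ := h.refl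
      obtain ⟨a2, b2, c2, h2⟩ := (h'.step hr.refl).refl
      refine ⟨a2, b2, c2, ?_⟩
      simp only [neg_neg] at h2
      convert h2 using 1
      ring
  intro n
  have hk0 : (0 : ℤ) < 2 * k := by omega
  obtain ⟨m, j, hj, rfl⟩ : ∃ (m : ℤ) (j : ℕ), j < 2 * k ∧ n = 2 * k * m + j := by
    refine ⟨n / (2 * k), (n % (2 * k)).toNat, ?_, ?_⟩
    · have := Int.emod_lt_of_pos n hk0
      omega
    · rw [Int.toNat_of_nonneg (Int.emod_nonneg _ hk0.ne')]
      exact (Int.mul_ediv_add_emod n _).symm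
  obtain ⟨a, b, c, h⟩ := key m
  have g1 := h.step hr
  have g2 := g1.step hr
  have g3 := g2.step hr
  rw [show (2 * k * m + j + 6 * k : ℤ) = 2 * k * (m + 1 + 1 + 1) + j by ring,
    show (2 * k * m + j + 4 * k : ℤ) = 2 * k * (m + 1 + 1) + j by ring,
    show (2 * k * m + j + 2 * k : ℤ) = 2 * k * (m + 1) + j by ring]
  rcases le_or_gt j k with hjk | hjk
  · rw [h.2.2.1 j hjk, g1.2.2.1 j hjk, g2.2.2.1 j hjk, g3.2.2.1 j hjk]
    ring
  · obtain ⟨i, rfl⟩ := Nat.exists_eq_add_of_le hjk.le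
    have hi : i ≤ k := by omega
    push_cast
    simp only [← add_assoc (2 * (k : ℤ) * _) (k : ℤ) (i : ℤ)]
    rw [h.2.2.2 i hi, g1.2.2.2 i hi, g2.2.2.2 i hi, g3.2.2.2 i hi]
    ring
end

section
/- Let N ≥ 2 be an integer, set p = N − 1, and let (x_n)_{n∈ℤ} be a sequence of nonzero rational numbers satisfying x_{n+N}·x_n = x_{n+N−1}·x_{n+1} + (x_{n+1} + x_{n+2} + … + x_{n+N−1}) for all n ∈ ℤ, with initial data x_i = 1 for i = 0, 1, …, p. Then every iterate is an integer: for all n ∈ ℤ there exists m ∈ ℤ with x_n = m. -/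
/-- Theorem 6.1 (integrality): with `p = N-1`, the sequence generated by
`x_{n+N} x_n = x_{n+N-1} x_{n+1} + (x_{n+1} + ⋯ + x_{n+N-1})` with all `N` initial values
equal to `1` consists entirely of integers. -/
theorem ones_integrality (N : ℕ) (hN : 2 ≤ N) (p : ℕ) (hp : p = N - 1)
    (x : ℤ → ℚ) (hx : ∀ n : ℤ, x n ≠ 0)
    (hrec : ∀ n : ℤ, x (n + N) * x n =
      x (n + N - 1) * x (n + 1) + ∑ i ∈ Finset.Ico 1 N, x (n + (i : ℤ)))
    (hinit : ∀ i : ℕ, i ≤ p → x (i : ℤ) = 1) :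
    ∀ n : ℤ, ∃ m : ℤ, x n = m := by
  obtain rfl : N = p + 1 := by omega
  have hp1 : 1 ≤ p := by omega
  have hrec' : ∀ n : ℤ, x (n + p + 1) * x n = x (n + p) * x (n + 1) +
      ∑ i ∈ Finset.range p, x (n + 1 + (i : ℤ)) := by
    intro n
    have h := hrec n
    rw [Finset.sum_Ico_eq_sum_range] at h
    push_cast at h
    simp only [Nat.add_sub_cancel, ← add_assoc, add_sub_cancel_right] at h
    exact h
  have htel : ∀ n : ℤ, ∑ i ∈ Finset.range p, x (n + 1 + 1 + (i : ℤ)) -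
      ∑ i ∈ Finset.range p, x (n + 1 + (i : ℤ)) = x (n + 1 + p) - x (n + 1) := by
    intro n
    have h := Finset.sum_range_sub (fun i : ℕ => x (n + 1 + (i : ℤ))) p
    rw [← Finset.sum_sub_distrib]
    simp only [Nat.cast_zero, add_zero] at h
    rw [← h]
    refine Finset.sum_congr rfl fun i _ => ?_
    congr 2
    push_cast
    ring
  have hJ : ∀ n : ℤ, x (n + 1) * (x (n + p + 2) + x (n + p) + 1) =
      x (n + p + 1) * (x (n + 2) + x n + 1) := by
    intro n
    have h1 := hrec' n
    have h2 := hrec' (n + 1)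
    have h3 := htel n
    rw [show n + 1 + (p : ℤ) + 1 = n + p + 2 by ring, show n + 1 + (p : ℤ) = n + p + 1 by ring] at h2
    rw [show n + 1 + (p : ℤ) = n + p + 1 by ring] at h3
    rw [show n + 1 + 1 = n + 2 by ring] at h2 h3
    linear_combination h2 - h1 + h3
  let J : ℤ → ℚ := fun n => (x (n + 2) + x n + 1) / x (n + 1)
  have hper : Function.Periodic J (p : ℤ) := by
    intro n
    simp only [J]
    rw [div_eq_div_iff (hx _) (hx _)]
    linear_combination hJ n
  have hi : ∀ i : ℤ, 0 ≤ i → i ≤ p → x i = 1 := by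
    intro i h0 h1
    lift i to ℕ using h0
    exact hinit i (by exact_mod_cast h1)
  have hnext : x (p + 1) = 1 + p := by
    have h := hrec' 0
    rw [Finset.sum_congr rfl (g := fun _ => (1 : ℚ))] at h
    · simp only [zero_add] at h
      rw [hi 0 (by omega) (by omega), hi p (by omega) (by omega), hi 1 (by omega) (by omega)] at h
      simpa using h
    · intro i hi'
      have := Finset.mem_range.1 hi'
      exact hi _ (by omega) (by omega)
  have hJbase : ∀ n : ℤ, 0 ≤ n → n < p → ∃ j : ℤ, J n = j := by
    intro n h0 h1
    simp only [J]
    rw [hi n h0 h1.le, hi (n + 1) (by omega) (by omega)]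
    rcases lt_or_ge (n + 1) (p : ℤ) with h | h
    · rw [hi (n + 2) (by omega) (by omega)]
      exact ⟨3, by norm_num⟩
    · rw [show n + 2 = (p : ℤ) + 1 by omega, hnext]
      exact ⟨p + 3, by push_cast; ring⟩
  have hJint : ∀ n : ℤ, ∃ j : ℤ, J n = j := by
    intro n
    obtain ⟨j, hj⟩ := hJbase (n % p) (Int.emod_nonneg _ (by omega)) (Int.emod_lt_of_pos _ (by omega))
    refine ⟨j, ?_⟩
    rw [← hj]
    have h := hper.int_mul (n / p) (n % p)
    rw [← h]
    congr 1
    have := Int.emod_add_mul_ediv n p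
    push_cast
    linarith
  have hstep : ∀ n : ℤ, ∃ j : ℤ, x (n + 2) + x n + 1 = j * x (n + 1) := by
    intro n
    obtain ⟨j, hj⟩ := hJint n
    refine ⟨j, ?_⟩
    rw [← hj]
    exact (div_mul_cancel₀ _ (hx _)).symm
  have key : ∀ n : ℤ, (∃ m : ℤ, x n = m) ∧ (∃ m : ℤ, x (n + 1) = m) := by
    intro n
    induction n using Int.induction_on with
    | zero => exact ⟨⟨1, by simpa using hi 0 (by omega) (by omega)⟩,
        ⟨1, by simpa using hi 1 (by omega) (by omega)⟩⟩
    | succ n ih =>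
      obtain ⟨⟨a, ha⟩, ⟨b, hb⟩⟩ := ih
      refine ⟨⟨b, hb⟩, ?_⟩
      obtain ⟨j, hj⟩ := hstep n
      refine ⟨j * b - a - 1, ?_⟩
      rw [show (n : ℤ) + 1 + 1 = n + 2 by ring]
      push_cast
      rw [ha, hb] at hj
      linear_combination hj
    | pred n ih =>
      obtain ⟨⟨a, ha⟩, ⟨b, hb⟩⟩ := ih
      refine ⟨?_, ⟨a, by rw [← ha]; congr 1; ring⟩⟩
      obtain ⟨j, hj⟩ := hstep (-n - 1)
      refine ⟨j * a - b - 1, ?_⟩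
      rw [show -(n : ℤ) - 1 + 2 = -n + 1 by ring, show -(n : ℤ) - 1 + 1 = -n by ring, ha, hb] at hj
      push_cast
      linear_combination hj
  exact fun n => (key n).1
end

section
/- Let N ≥ 2 be an integer, set p = N − 1, and let (x_n)_{n∈ℤ} be a sequence of nonzero rational numbers satisfying x_{n+N}·x_n = x_{n+N−1}·x_{n+1} + (x_{n+1} + x_{n+2} + … + x_{n+N−1}) for all n ∈ ℤ, with initial data x_i = 1 for i = 0, 1, …, p. Then x_{p+j} = F_{2j}·p + 1 for all j with 0 ≤ j ≤ p, where F_m denotes the m-th Fibonacci number (F_0 = 0, F_1 = 1). -/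
/-- Theorem 6.1, first set of formulas in (37): with `p = N-1` and all `N` initial values
equal to `1`, the second block of iterates is `x_{p+j} = F_{2j} p + 1` for `0 ≤ j ≤ p`. -/
theorem ones_second_block (N : ℕ) (hN : 2 ≤ N) (p : ℕ) (hp : p = N - 1)
    (x : ℤ → ℚ) (hx : ∀ n : ℤ, x n ≠ 0)
    (hrec : ∀ n : ℤ, x (n + N) * x n =
      x (n + N - 1) * x (n + 1) + ∑ i ∈ Finset.Ico 1 N, x (n + (i : ℤ)))
    (hinit : ∀ i : ℕ, i ≤ p → x (i : ℤ) = 1) :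
    ∀ j : ℕ, j ≤ p → x ((p : ℤ) + j) = (Nat.fib (2 * j) : ℚ) * p + 1 := by
  obtain rfl : N = p + 1 := by omega
  have hS : ∀ n : ℤ, ∑ i ∈ Finset.Ico 1 (p + 1), x (n + (i : ℤ)) =
      ∑ i ∈ Finset.range p, x (n + 1 + (i : ℤ)) := by
    intro n
    rw [Finset.sum_Ico_eq_sum_range]
    refine Finset.sum_congr (by simp) fun i _ => ?_
    congr 1
    push_cast
    ring
  have hshift : ∀ n : ℤ, ∑ i ∈ Finset.range p, x (n + 1 + (i : ℤ)) + x n =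
      ∑ i ∈ Finset.range p, x (n + (i : ℤ)) + x (n + p) := by
    intro n
    rw [← Finset.sum_range_succ (fun i : ℕ => x (n + (i : ℤ))), Finset.sum_range_succ']
    congr 1
    · refine Finset.sum_congr rfl fun i _ => ?_
      congr 1
      push_cast
      ring
    · simp
  have key : ∀ j : ℕ, j ≤ p → x ((p : ℤ) + j) = (Nat.fib (2 * j) : ℚ) * p + 1 ∧
      ∑ i ∈ Finset.range p, x ((j : ℤ) + 1 + (i : ℤ)) = (Nat.fib (2 * j + 1) : ℚ) * p := by
    intro j
    induction j with
    | zero =>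
      intro _
      refine ⟨by simpa using hinit p le_rfl, ?_⟩
      have : ∀ i ∈ Finset.range p, x (((0 : ℕ) : ℤ) + 1 + (i : ℤ)) = 1 := by
        intro i hi
        have h := hinit (i + 1) (by have := Finset.mem_range.1 hi; omega)
        rw [← h]
        congr 1
        push_cast
        ring
      rw [Finset.sum_congr rfl this]
      simp
    | succ j ih =>
      intro hj
      obtain ⟨h1, h2⟩ := ih (by omega)
      have hr := hrec j
      have hsh := hshift ((j : ℤ) + 1)
      have e0 := hinit j (by omega)
      have e1 := hinit (j + 1) hj
      push_cast at e1
      rw [hS, h2, e0, e1] at hr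
      rw [h2, e1] at hsh
      have a1 : (j : ℤ) + ((p + 1 : ℕ) : ℤ) - 1 = p + j := by push_cast; ring
      have a2 : (j : ℤ) + ((p + 1 : ℕ) : ℤ) = p + (j + 1 : ℕ) := by push_cast; ring
      have a3 : (j : ℤ) + 1 + (p : ℤ) = p + (j + 1 : ℕ) := by push_cast; ring
      rw [a1, a2, h1] at hr
      rw [a3] at hsh
      have f1 : (Nat.fib (2 * (j + 1)) : ℚ) = Nat.fib (2 * j) + Nat.fib (2 * j + 1) := by
        exact_mod_cast Nat.fib_add_two (n := 2 * j)
      have f2 : (Nat.fib (2 * (j + 1) + 1) : ℚ) =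
          Nat.fib (2 * j + 1) + Nat.fib (2 * (j + 1)) := by
        exact_mod_cast Nat.fib_add_two (n := 2 * j + 1)
      have r1 : x ((p : ℤ) + (j + 1 : ℕ)) = (Nat.fib (2 * (j + 1)) : ℚ) * p + 1 := by
        rw [f1]; linarith
      refine ⟨r1, ?_⟩
      rw [r1] at hsh
      rw [f2]
      push_cast
      linarith
  exact fun j hj => (key j hj).1
end

section
/- Let N ≥ 2 be an integer, set p = N − 1, and let (x_n)_{n∈ℤ} be a sequence of nonzero rational numbers satisfying x_{n+N}·x_n = x_{n+N−1}·x_{n+1} + (x_{n+1} + x_{n+2} + … + x_{n+N−1}) for all n ∈ ℤ, with initial data x_i = 1 for i = 0, 1, …, p. Then for all j with 1 ≤ j ≤ p, x_{2p+j} = F_{2j}·F_{2p}·p² + (F_{2j}·(F_{2p+2} + 1) − F_{2j−2}·F_{2p})·p + 1, where F_m denotes the m-th Fibonacci number (F_0 = 0, F_1 = 1). -/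
/-- Theorem 6.1, second set of formulas in (37): with `p = N-1` and all `N` initial values
equal to `1`, the third block of iterates is
`x_{2p+j} = F_{2j} F_{2p} p² + (F_{2j}(F_{2p+2}+1) - F_{2j-2} F_{2p}) p + 1` for `1 ≤ j ≤ p`. -/
theorem ones_third_block (N : ℕ) (hN : 2 ≤ N) (p : ℕ) (hp : p = N - 1)
    (x : ℤ → ℚ) (hx : ∀ n : ℤ, x n ≠ 0)
    (hrec : ∀ n : ℤ, x (n + N) * x n =
      x (n + N - 1) * x (n + 1) + ∑ i ∈ Finset.Ico 1 N, x (n + (i : ℤ)))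
    (hinit : ∀ i : ℕ, i ≤ p → x (i : ℤ) = 1) :
    ∀ j : ℕ, 1 ≤ j → j ≤ p →
      x (2 * (p : ℤ) + j) = (Nat.fib (2 * j) : ℚ) * Nat.fib (2 * p) * (p : ℚ) ^ 2 +
        ((Nat.fib (2 * j) : ℚ) * ((Nat.fib (2 * p + 2) : ℚ) + 1) -
          (Nat.fib (2 * j - 2) : ℚ) * Nat.fib (2 * p)) * p + 1 := by
  obtain rfl : N = p + 1 := by omega
  set w : ℤ → ℚ := fun n => ∑ i ∈ Finset.Ico 1 (p + 1), x (n + (i : ℤ)) with hw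
  have hrec' : ∀ n : ℤ, x (n + p + 1) * x n = x (n + p) * x (n + 1) + w n := by
    intro n
    have h := hrec n
    have e1 : n + ((p + 1 : ℕ) : ℤ) = n + p + 1 := by push_cast; ring
    have e2 : n + p + 1 - 1 = n + (p : ℤ) := by ring
    rw [e1, e2] at h
    exact h
  have hwin : ∀ n : ℤ, w (n + 1) = w n - x (n + 1) + x (n + p + 1) := by
    intro n
    have key : w n = ∑ i ∈ Finset.range p, x (n + 1 + (i : ℤ)) := by
      simp only [hw]
      rw [Finset.sum_Ico_eq_sum_range]
      apply Finset.sum_congr rfl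
      intro i _
      congr 1
      push_cast
      ring
    have key2 : w (n + 1) = ∑ i ∈ Finset.range p, x (n + 1 + ((i + 1 : ℕ) : ℤ)) := by
      simp only [hw]
      rw [Finset.sum_Ico_eq_sum_range]
      apply Finset.sum_congr rfl
      intro i _
      congr 1
      push_cast
      ring
    have h1 := Finset.sum_range_succ (fun i : ℕ => x (n + 1 + (i : ℤ))) p
    have h2 := Finset.sum_range_succ' (fun i : ℕ => x (n + 1 + (i : ℤ))) p
    rw [h1] at h2
    have e : n + 1 + (p : ℤ) = n + p + 1 := by ring
    simp only [Nat.cast_zero, add_zero, e] at h2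
    rw [key, key2]
    linarith
  have hw0 : w 0 = p := by
    simp only [hw]
    rw [Finset.sum_congr rfl (g := fun _ => (1 : ℚ))]
    · simp
    · intro i hi
      rw [Finset.mem_Ico] at hi
      rw [zero_add]
      exact hinit i (by omega)
  have f2 : ∀ k : ℕ, (Nat.fib (2 * (k + 1)) : ℚ) = Nat.fib (2 * k) + Nat.fib (2 * k + 1) := by
    intro k
    rw [show 2 * (k + 1) = 2 * k + 2 by ring, Nat.fib_add_two]
    push_cast; ring
  have f3 : ∀ k : ℕ, (Nat.fib (2 * (k + 1) + 1) : ℚ)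
      = Nat.fib (2 * k) + 2 * Nat.fib (2 * k + 1) := by
    intro k
    rw [show 2 * (k + 1) + 1 = 2 * k + 1 + 2 by ring, Nat.fib_add_two,
      show 2 * k + 1 + 1 = 2 * k + 2 by ring, Nat.fib_add_two]
    push_cast; ring
  have cas : ∀ k : ℕ, (Nat.fib (2 * k + 1) : ℚ) ^ 2 - Nat.fib (2 * k) * Nat.fib (2 * k + 1)
      - (Nat.fib (2 * k) : ℚ) ^ 2 = 1 := by
    intro k
    induction k with
    | zero => simp
    | succ k ih => rw [f2, f3]; linear_combination ih
  have second : ∀ k : ℕ, k ≤ p → x ((p : ℤ) + k) = 1 + p * Nat.fib (2 * k) ∧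
      w (k : ℤ) = p * Nat.fib (2 * k + 1) := by
    intro k
    induction k with
    | zero =>
      intro _
      refine ⟨?_, ?_⟩
      · simpa using hinit p le_rfl
      · simpa using hw0
    | succ k ih =>
      intro hk
      obtain ⟨h1, h2⟩ := ih (by omega)
      have a0 := hinit k (by omega)
      have a1 := hinit (k + 1) hk
      have r := hrec' k
      have v := hwin k
      push_cast at a1 ⊢
      rw [show (k : ℤ) + p = p + k by ring] at r v
      rw [show (p : ℤ) + k + 1 = p + (k + 1) by ring] at r v
      rw [a0, a1, h1, h2] at r
      rw [a1, h2] at v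
      have r' : x ((p : ℤ) + (k + 1)) = 1 + p * Nat.fib (2 * (k + 1)) := by
        rw [f2]; linear_combination r
      refine ⟨r', ?_⟩
      rw [v, r', f2, f3]; ring
  have third : ∀ k : ℕ, k ≤ p → x (2 * (p : ℤ) + k) =
      (Nat.fib (2 * k) : ℚ) * Nat.fib (2 * p) * (p : ℚ) ^ 2 +
        ((Nat.fib (2 * k) : ℚ) * ((Nat.fib (2 * p + 1) : ℚ) + 1 - Nat.fib (2 * p)) +
          (Nat.fib (2 * k + 1) : ℚ) * Nat.fib (2 * p)) * p + 1 ∧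
      w ((p : ℤ) + k) = p * (Nat.fib (2 * p + 1) - Nat.fib (2 * k + 1)) + p +
        ((Nat.fib (2 * k + 1) : ℚ) - 1) * Nat.fib (2 * p) * (p : ℚ) ^ 2 +
        (((Nat.fib (2 * k + 1) : ℚ) - 1) * ((Nat.fib (2 * p + 1) : ℚ) + 1 - Nat.fib (2 * p)) +
          ((Nat.fib (2 * k) : ℚ) + Nat.fib (2 * k + 1) - 1) * Nat.fib (2 * p)) * p := by
    intro k
    induction k with
    | zero =>
      intro _
      obtain ⟨h1, h2⟩ := second p le_rfl
      refine ⟨?_, ?_⟩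
      · rw [← two_mul] at h1
        simp [h1]; ring
      · simp [h2]; try ring
    | succ k ih =>
      intro hk
      obtain ⟨h1, h2⟩ := ih (by omega)
      have a0 := (second k (by omega)).1
      have a1 := (second (k + 1) hk).1
      have r := hrec' (p + k)
      have v := hwin (p + k)
      have nz := hx (p + k)
      push_cast at a1 ⊢
      rw [show (p : ℤ) + k + p = 2 * p + k by ring] at r v
      rw [show 2 * (p : ℤ) + k + 1 = 2 * p + (k + 1) by ring,
        show (p : ℤ) + k + 1 = p + (k + 1) by ring] at r v
      rw [show (p : ℤ) + (k + 1) = p + (k + 1) by ring]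
      rw [a0, a1, h1, h2] at r
      rw [a1, h2] at v
      rw [a0] at nz
      rw [f2] at r v
      have c := cas k
      have r' : x (2 * (p : ℤ) + (k + 1)) =
        (Nat.fib (2 * (k + 1)) : ℚ) * Nat.fib (2 * p) * (p : ℚ) ^ 2 +
        ((Nat.fib (2 * (k + 1)) : ℚ) * ((Nat.fib (2 * p + 1) : ℚ) + 1 - Nat.fib (2 * p)) +
          (Nat.fib (2 * (k + 1) + 1) : ℚ) * Nat.fib (2 * p)) * p + 1 := by
        apply mul_right_cancel₀ nz
        rw [r, f2, f3]
        linear_combination ((Nat.fib (2 * p) : ℚ) * p ^ 2) * c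
      refine ⟨r', ?_⟩
      rw [v, r', f2, f3]; ring
  intro j hj hjp
  obtain ⟨m, rfl⟩ : ∃ m, j = m + 1 := ⟨j - 1, by omega⟩
  rw [(third (m + 1) hjp).1]
  rw [show 2 * (m + 1) - 2 = 2 * m by omega, show 2 * p + 2 = 2 * (p + 1) by ring,
    f2 p, f2 m, f3 m]
  ring
end

section
/- Let N ≥ 2 be an integer, set p = N − 1, and let (x_n)_{n∈ℤ} be a sequence of nonzero rational numbers satisfying x_{n+N}·x_n = x_{n+N−1}·x_{n+1} + (x_{n+1} + x_{n+2} + … + x_{n+N−1}) for all n ∈ ℤ, with initial data x_i = 1 for i = 0, 1, …, p. Let Ψ_0 be the 3×3 matrix whose (i,j) entry (0 ≤ i, j ≤ 2) is x_{i+(N−1)j}. Then det Ψ_0 = F_{2p}·p², where F_m denotes the m-th Fibonacci number (F_0 = 0, F_1 = 1); in particular det Ψ_0 ≠ 0. -/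
/-- Remark 3.2: with `p = N-1` and all `N` initial values equal to `1` (parameter `a = 1`),
the determinant of the 3×3 matrix `Ψ_0`, with `(i,j)` entry `x (i + (N-1)j)`, equals
`F_{2p} p²`; in particular it is nonzero. -/
theorem ones_det_psi (N : ℕ) (hN : 2 ≤ N) (p : ℕ) (hp : p = N - 1)
    (x : ℤ → ℚ) (hx : ∀ n : ℤ, x n ≠ 0)
    (hrec : ∀ n : ℤ, x (n + N) * x n =
      x (n + N - 1) * x (n + 1) + ∑ i ∈ Finset.Ico 1 N, x (n + (i : ℤ)))
    (hinit : ∀ i : ℕ, i ≤ p → x (i : ℤ) = 1) :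
    Matrix.det (Matrix.of fun i j : Fin 3 =>
        x (((i : ℕ) : ℤ) + ((N : ℤ) - 1) * ((j : ℕ) : ℤ))) =
      (Nat.fib (2 * p) : ℚ) * (p : ℚ) ^ 2 ∧
    Matrix.det (Matrix.of fun i j : Fin 3 =>
        x (((i : ℕ) : ℤ) + ((N : ℤ) - 1) * ((j : ℕ) : ℤ))) ≠ 0 := by
  obtain ⟨q, rfl⟩ : ∃ q, N = q + 1 := ⟨N - 1, by omega⟩
  obtain rfl : p = q := by omega
  have hp1 : 1 ≤ p := by omega
  set y : ℕ → ℚ := fun k => x (k : ℤ) with hy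
  set W : ℕ → ℚ := fun k => ∑ i ∈ Finset.range p, y (k + 1 + i) with hW
  have hone : ∀ i, i ≤ p → y i = 1 := hinit
  have hr : ∀ k : ℕ, y (k + p + 1) * y k = y (k + p) * y (k + 1) + W k := by
    intro k
    have h := hrec k
    rw [Finset.sum_Ico_eq_sum_range] at h
    simp only [hW, hy]
    push_cast at h ⊢
    convert h using 2
    · congr 1
    · congr 2; ring
    · refine Finset.sum_congr rfl fun i _ => ?_
      congr 1; ring
  have hWs : ∀ k, W (k + 1) + y (k + 1) = W k + y (k + p + 1) := by
    intro k
    have h1 := Finset.sum_range_succ (fun i => y (k + 1 + i)) p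
    have h2 := Finset.sum_range_succ' (fun i => y (k + 1 + i)) p
    rw [h1] at h2
    simp only [hW]
    have h3 : k + p + 1 = k + 1 + p := by ring
    rw [h3, h2]
    simp only [add_zero]
    congr 1
    refine Finset.sum_congr rfl fun i _ => ?_
    congr 1; ring
  have hW0 : W 0 = p := by
    simp only [hW]
    rw [Finset.sum_congr rfl (g := fun _ => (1 : ℚ))]
    · simp
    · intro i hi
      exact hone _ (by have := Finset.mem_range.1 hi; omega)
  have key : ∀ k, k ≤ p → y (k + p) = 1 + p * Nat.fib (2 * k) ∧
      W k = p * Nat.fib (2 * k + 1) := by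
    intro k
    induction k with
    | zero => intro _; simp [hW0, hone]
    | succ k ih =>
      intro hk
      obtain ⟨h1, h2⟩ := ih (by omega)
      have a := hr k
      have b := hWs k
      rw [hone k (by omega), hone (k + 1) hk, h1, h2] at a
      rw [hone (k + 1) hk, h2] at b
      have e : k + 1 + p = k + p + 1 := by ring
      have f1 : (Nat.fib (2 * (k + 1)) : ℚ) = Nat.fib (2 * k) + Nat.fib (2 * k + 1) := by
        exact_mod_cast Nat.fib_add_two (n := 2 * k)
      have f2 : (Nat.fib (2 * (k + 1) + 1) : ℚ) =
          Nat.fib (2 * k + 1) + Nat.fib (2 * (k + 1)) := by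
        exact_mod_cast Nat.fib_add_two (n := 2 * k + 1)
      rw [e, f2, f1]
      constructor <;> linarith
  have hdet : Matrix.det (Matrix.of fun i j : Fin 3 =>
        x (((i : ℕ) : ℤ) + (((p + 1 : ℕ) : ℤ) - 1) * ((j : ℕ) : ℤ))) =
      (Nat.fib (2 * p) : ℚ) * (p : ℚ) ^ 2 := by
    have hent : (Matrix.of fun i j : Fin 3 =>
        x (((i : ℕ) : ℤ) + (((p + 1 : ℕ) : ℤ) - 1) * ((j : ℕ) : ℤ))) =
        Matrix.of fun i j : Fin 3 => y ((i : ℕ) + p * (j : ℕ)) := by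
      ext i j
      simp only [Matrix.of_apply, hy]
      congr 1; push_cast; ring
    rw [hent, Matrix.det_fin_three]
    simp only [Matrix.of_apply, Fin.val_zero, Fin.val_one, Fin.val_two, mul_zero, mul_one,
      add_zero, zero_add]
    rcases Nat.lt_or_ge p 2 with h | h
    · obtain rfl : p = 1 := by omega
      have r0 := hr 0
      have r1 := hr 1
      have r2 := hr 2
      have y0 := hone 0 (by omega)
      have y1 := hone 1 (by omega)
      simp [hW] at r0 r1 r2
      norm_num [y0, y1] at r0 r1 r2 ⊢
      have e2 : y 2 = 2 := by linarith
      rw [e2] at r1 r2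
      have e3 : y 3 = 6 := by linarith
      rw [e3] at r2
      have e4 : y 4 = 21 := by linarith
      rw [e2, e3, e4]; norm_num
    · have y0 := hone 0 (by omega)
      have y1 := hone 1 (by omega)
      have y2 := hone 2 (by omega)
      have yp := hone p le_rfl
      have k1 := (key 1 (by omega)).1
      have k2 := (key 2 h).1
      obtain ⟨k3, w3⟩ := key p le_rfl
      have rp := hr p
      have rq := hr (p + 1)
      have ws := hWs p
      have g2 : Nat.fib (2 * 1) = 1 := by decide
      have g4 : Nat.fib (2 * 2) = 3 := by decide
      rw [g2] at k1
      rw [g4] at k2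
      have n1 : p + 1 = 1 + p := by ring
      have n2 : p + 1 + 1 = 2 + p := by ring
      have n3 : p + p + 1 = 1 + p * 2 := by ring
      have n4 : p + 1 + p + 1 = 2 + p * 2 := by ring
      have n5 : p + 1 + p = 1 + p * 2 := by ring
      have n6 : p + p = p * 2 := by ring
      rw [n6] at k3
      rw [n3, n6, n1, yp, k1, k3, w3] at rp
      rw [n4, n5, n2, n1, k1, k2] at rq
      rw [n3, n1, k1, w3] at ws
      rw [y0, y1, y2, yp, k1, k2, k3]
      push_cast at *
      generalize (Nat.fib (2 * p) : ℚ) = f at *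
      generalize (Nat.fib (2 * p + 1) : ℚ) = g at *
      have hpp : (1 + (p : ℚ) * 1) ≠ 0 := by positivity
      have e : y (2 + p * 2) = 3 * y (1 + p * 2) - 2 - p * f := by
        apply mul_right_cancel₀ hpp
        linear_combination rq + ws - rp
      rw [e]; ring
  refine ⟨hdet, ?_⟩
  rw [hdet]
  have : 0 < Nat.fib (2 * p) := Nat.fib_pos.2 (by omega)
  positivity
end

section
/- Let K be a field, a ∈ K, and let (x_n)_{n∈ℤ} be a sequence in K with x_n ≠ 0 for all n, satisfying x_{n+3}·x_n = x_{n+2}·x_{n+1} + a·(x_{n+2} + x_{n+1}) for all n ∈ ℤ. Then x_{n+6} − K·(x_{n+4} − x_{n+2}) − x_n = 0 for all n ∈ ℤ, where K = 1 + x_0/x_2 + x_2/x_0 + a·(x_0/(x_1·x_2) + x_2/(x_0·x_1) + 2·(1/x_0 + 1/x_1 + 1/x_2)) + a²·(1/(x_0·x_1) + 1/(x_1·x_2) + 1/(x_2·x_0)). -/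
/-- The first integral. -/
def kInt {K : Type*} [Field K] (a p q r : K) : K :=
  1 + p / r + r / p +
        a * (p / (q * r) + r / (p * q) + 2 * (1 / p + 1 / q + 1 / r)) +
        a ^ 2 * (1 / (p * q) + 1 / (q * r) + 1 / (r * p))

theorem kInt_step {K : Type*} [Field K] (a p q r s : K) (hp : p ≠ 0) (hq : q ≠ 0)
    (hr : r ≠ 0) (hs : s ≠ 0) (h : s * p = r * q + a * (r + q)) :
    kInt a q r s = kInt a p q r := by
  have e : (kInt a q r s - kInt a p q r) * (p * q * r * s)
      = (s * p - (r * q + a * (r + q))) * (s * r - p * q + a * (s - p)) := by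
    unfold kInt
    field_simp
    ring
  rw [h, sub_self, zero_mul] at e
  have hne : p * q * r * s ≠ 0 := mul_ne_zero (mul_ne_zero (mul_ne_zero hp hq) hr) hs
  exact sub_eq_zero.mp ((mul_eq_zero.mp e).resolve_right hne)

theorem kInt_rel {K : Type*} [Field K] (a p q r s t u v : K) (hp : p ≠ 0) (hq : q ≠ 0)
    (hr : r ≠ 0) (hs : s ≠ 0) (h : s * p = r * q + a * (r + q))
    (h1 : t * q = s * r + a * (s + r)) (h2 : u * r = t * s + a * (t + s))
    (h3 : v * s = u * t + a * (u + t)) :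
    v - kInt a p q r * (t - r) - p = 0 := by
  have e : (v - kInt a p q r * (t - r) - p) * s = 0 := by
    have e1 : (v - kInt a p q r * (t - r) - p) * s
      = u * t + a * (u + t) - (kInt a p q r * (t - r) + p) * s := by rw [← h3]; ring
    rw [e1]
    have d : s = (r * q + a * (r + q)) / p := by rw [← h]; field_simp
    have d1 : t = (s * r + a * (s + r)) / q := by rw [← h1]; field_simp
    have d2 : u = (t * s + a * (t + s)) / r := by rw [← h2]; field_simp
    rw [d2, d1, d]
    unfold kInt
    field_simp
    ring
  exact (mul_eq_zero.mp e).resolve_right hs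

/-- Example 3.6 (the case `N = 3`): the iterates of
`x_{n+3} x_n = x_{n+2} x_{n+1} + a (x_{n+2} + x_{n+1})` satisfy
`x_{n+6} - K (x_{n+4} - x_{n+2}) - x_n = 0` with the explicit first integral `K`
given as a Laurent polynomial in `x_0, x_1, x_2` with polynomial dependence on `a`. -/
theorem example_N3_K {K : Type*} [Field K] (a : K)
    (x : ℤ → K) (hx : ∀ n : ℤ, x n ≠ 0)
    (hrec : ∀ n : ℤ, x (n + 3) * x n = x (n + 2) * x (n + 1) + a * (x (n + 2) + x (n + 1))) :
    ∀ n : ℤ, x (n + 6) -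
      (1 + x 0 / x 2 + x 2 / x 0 +
        a * (x 0 / (x 1 * x 2) + x 2 / (x 0 * x 1) + 2 * (1 / x 0 + 1 / x 1 + 1 / x 2)) +
        a ^ 2 * (1 / (x 0 * x 1) + 1 / (x 1 * x 2) + 1 / (x 2 * x 0))) *
      (x (n + 4) - x (n + 2)) - x n = 0 := by
  have step : ∀ n : ℤ, kInt a (x (n + 1)) (x (n + 2)) (x (n + 3))
      = kInt a (x n) (x (n + 1)) (x (n + 2)) := fun n =>
    kInt_step a _ _ _ _ (hx _) (hx _) (hx _) (hx _) (hrec n)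
  have inv : ∀ n : ℤ, kInt a (x n) (x (n + 1)) (x (n + 2)) = kInt a (x 0) (x 1) (x 2) := by
    intro n
    induction n using Int.induction_on with
    | zero => simp
    | succ i ih =>
      rw [← ih, ← step (i : ℤ)]
      congr 2 <;> ring
    | pred i ih =>
      rw [← ih, ← step (-(i : ℤ) - 1)]
      congr 2 <;> ring
  intro n
  have e := kInt_rel a (x n) (x (n + 1)) (x (n + 2)) (x (n + 3)) (x (n + 4)) (x (n + 5))
    (x (n + 6)) (hx _) (hx _) (hx _) (hx _) (hrec n)
    (by have := hrec (n + 1); ring_nf at this ⊢; exact this)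
    (by have := hrec (n + 2); ring_nf at this ⊢; exact this)
    (by have := hrec (n + 3); ring_nf at this ⊢; exact this)
  rw [inv n] at e
  exact e
end

section
/- Let K be a field, a ∈ K, and let (x_n)_{n∈ℤ} be a sequence in K with x_n ≠ 0 for all n, satisfying x_{n+3}·x_n = x_{n+2}·x_{n+1} + a·(x_{n+2} + x_{n+1}) for all n ∈ ℤ. Set J_0 = (x_2 + x_0 + a)/x_1 and J_1 = (x_1·x_0 + x_2·x_1 + a·(x_0 + x_1 + x_2))/(x_2·x_0). Then x_{n+6} − (J_0·J_1 − 1)·(x_{n+4} − x_{n+2}) − x_n = 0 for all n ∈ ℤ. -/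
/-- Example 4.2 (the case `N = 3`, period `p = 2`): the constant coefficient of the linear
relation for `x_{n+3} x_n = x_{n+2} x_{n+1} + a (x_{n+2} + x_{n+1})` is `J_0 J_1 - 1` in
terms of the period-2 quantities `J_0, J_1`. -/
theorem example_N3_J {K : Type*} [Field K] (a : K)
    (x : ℤ → K) (hx : ∀ n : ℤ, x n ≠ 0)
    (hrec : ∀ n : ℤ, x (n + 3) * x n = x (n + 2) * x (n + 1) + a * (x (n + 2) + x (n + 1)))
    (J₀ J₁ : K)
    (hJ₀ : J₀ = (x 2 + x 0 + a) / x 1)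
    (hJ₁ : J₁ = (x 1 * x 0 + x 2 * x 1 + a * (x 0 + x 1 + x 2)) / (x 2 * x 0)) :
    ∀ n : ℤ, x (n + 6) - (J₀ * J₁ - 1) * (x (n + 4) - x (n + 2)) - x n = 0 := by
  obtain ⟨J, hJ⟩ : ∃ J : ℤ → K, ∀ n, J n = (x (n + 2) + x n + a) / x (n + 1) := ⟨_, fun _ => rfl⟩
  have hJm : ∀ n, J n * x (n + 1) = x (n + 2) + x n + a := by
    intro n
    rw [hJ, div_mul_cancel₀ _ (hx _)]
  have hper : ∀ n, J (n + 2) = J n := by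
    intro n
    have h1 := hrec n
    have h2 := hrec (n + 1)
    rw [hJ, hJ, div_eq_div_iff (hx _) (hx _)]
    simp only [add_assoc] at h1 h2 ⊢
    norm_num at h1 h2 ⊢
    linear_combination h2 - h1
  have hstep : ∀ n, J (n + 1) * J (n + 1 + 1) = J n * J (n + 1) := by
    intro n
    rw [show n + 1 + 1 = n + 2 by ring, hper, mul_comm]
  have hconst : ∀ n, J n * J (n + 1) = J 0 * J 1 := by
    intro n
    induction n using Int.induction_on with
    | zero => simp
    | succ i ih => rw [hstep, ih]
    | pred i ih =>
      have h := hstep (-(i : ℤ) - 1)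
      rw [sub_add_cancel] at h
      rw [sub_add_cancel, ← h, ih]
  have e0 : J₀ = J 0 := by
    rw [hJ₀, hJ]
    norm_num
  have e1 : J₁ = J 1 := by
    have h := hrec 0
    have h0 := hx 0
    have h2 := hx 2
    rw [hJ₁, hJ]
    norm_num at h ⊢
    rw [div_eq_div_iff (mul_ne_zero h2 h0) h2]
    linear_combination (-(x 2)) * h
  intro n
  rw [e0, e1, ← hconst n]
  have a0 := hJm n
  have a1 := hJm (n + 1)
  have a2 := hJm (n + 2)
  have a3 := hJm (n + 3)
  have a4 := hJm (n + 4)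
  have p2 := hper n
  have p3 := hper (n + 1)
  have p4 := hper (n + 2)
  simp only [add_assoc] at a0 a1 a2 a3 a4 p2 p3 p4
  norm_num at a0 a1 a2 a3 a4 p2 p3 p4
  rw [p4, p2] at a4
  rw [p2] at a2
  rw [p3] at a3
  linear_combination a0 - a4 + J n * a1 - J n * a3
end

section
/- Let K be a field, a ∈ K, and let (x_n)_{n∈ℤ} be a sequence in K with x_n ≠ 0 for all n, satisfying x_{n+4}·x_n = x_{n+3}·x_{n+1} + a·(x_{n+1} + x_{n+2} + x_{n+3}) for all n ∈ ℤ. Set J_0 = (x_0 + x_2 + a)/x_1, J_1 = (x_1 + x_3 + a)/x_2, and J_2 = (x_0·x_2 + x_1·x_3 + a·(x_0 + x_1 + x_2 + x_3))/(x_0·x_3). Then x_{n+9} − K·(x_{n+6} − x_{n+3}) − x_n = 0 for all n ∈ ℤ, where K = J_0·J_1·J_2 − (J_0 + J_1 + J_2) + 1. -/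
/-- Example 4.3 (the case `N = 4`, period `p = 3`): the iterates of
`x_{n+4} x_n = x_{n+3} x_{n+1} + a (x_{n+1} + x_{n+2} + x_{n+3})` satisfy
`x_{n+9} - K (x_{n+6} - x_{n+3}) - x_n = 0` with `K = J_0 J_1 J_2 - (J_0 + J_1 + J_2) + 1`
in terms of the period-3 quantities `J_0, J_1, J_2`. -/
theorem example_N4_J {K : Type*} [Field K] (a : K)
    (x : ℤ → K) (hx : ∀ n : ℤ, x n ≠ 0)
    (hrec : ∀ n : ℤ, x (n + 4) * x n =
      x (n + 3) * x (n + 1) + a * (x (n + 1) + x (n + 2) + x (n + 3)))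
    (J₀ J₁ J₂ : K)
    (hJ₀ : J₀ = (x 0 + x 2 + a) / x 1)
    (hJ₁ : J₁ = (x 1 + x 3 + a) / x 2)
    (hJ₂ : J₂ = (x 0 * x 2 + x 1 * x 3 + a * (x 0 + x 1 + x 2 + x 3)) / (x 0 * x 3)) :
    ∀ n : ℤ, x (n + 9) - (J₀ * J₁ * J₂ - (J₀ + J₁ + J₂) + 1) * (x (n + 6) - x (n + 3))
      - x n = 0 := by
  obtain ⟨J, hJ⟩ : ∃ J : ℤ → K, ∀ n, J n = (x n + x (n + 2) + a) / x (n + 1) := ⟨_, fun _ => rfl⟩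
  have hl : ∀ n, x (n + 2) = J n * x (n + 1) - x n - a := by
    intro n
    rw [hJ, div_mul_cancel₀ _ (hx _)]
    ring
  have hper : ∀ n, J (n + 3) = J n := by
    intro n
    rw [hJ, hJ, div_eq_div_iff (hx _) (hx _)]
    have h1 := hrec n
    have h2 := hrec (n + 1)
    simp only [add_assoc] at h2 ⊢
    norm_num at h2 ⊢
    linear_combination h2 - h1
  have hS : ∀ n, J n * J (n + 1) * J (n + 2) - (J n + J (n + 1) + J (n + 2)) + 1
      = J₀ * J₁ * J₂ - (J₀ + J₁ + J₂) + 1 := by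
    have hstep : ∀ n, J (n + 1) * J (n + 1 + 1) * J (n + 1 + 2)
          - (J (n + 1) + J (n + 1 + 1) + J (n + 1 + 2)) + 1
        = J n * J (n + 1) * J (n + 2) - (J n + J (n + 1) + J (n + 2)) + 1 := by
      intro n
      have h := hper n
      simp only [add_assoc]
      norm_num
      rw [h]
      ring
    intro n
    induction n using Int.induction_on with
    | zero =>
      have e0 : J 0 = J₀ := by rw [hJ, hJ₀]; norm_num
      have e1 : J 1 = J₁ := by rw [hJ, hJ₁]; norm_num
      have e2 : J 2 = J₂ := by
        rw [hJ, hJ₂]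
        have h := hrec 0
        norm_num at h ⊢
        rw [div_eq_div_iff (hx _) (mul_ne_zero (hx _) (hx _))]
        linear_combination x 3 * h
      norm_num
      rw [e0, e1, e2]
    | succ i ih => rw [hstep, ih]
    | pred i ih =>
      have h := hstep (-(i : ℤ) - 1)
      rw [sub_add_cancel] at h
      rw [sub_add_cancel, ← h, ih]
  intro n
  rw [← hS n]
  have p0 := hper n
  have p1 := hper (n + 1)
  have p2 := hper (n + 2)
  have p3 := hper (n + 3)
  have p4 := hper (n + 4)
  have l0 := hl n
  have l1 := hl (n + 1)
  have l2 := hl (n + 2)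
  have l3 := hl (n + 3)
  have l4 := hl (n + 4)
  have l5 := hl (n + 5)
  have l6 := hl (n + 6)
  have l7 := hl (n + 7)
  simp only [add_assoc] at *
  norm_num at p0 p1 p2 p3 p4 l0 l1 l2 l3 l4 l5 l6 l7
  rw [p0] at p3
  rw [p1] at p4
  rw [l7, l6, l5, l4, l3, l2, l1, l0, p4, p3, p2, p1, p0]
  ring
end
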